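/- arXiv:math/0601061 — 9 statements merged into one kernel-verified Lean document; each statement's English description precedes it below -/
import Mathlib

section
/- Let M be a monoid, let X and Y be finite alphabets, and let φ : X* → M and ψ : Y* → M be surjective monoid homomorphisms. If a language L ⊆ Σ* (Σ a finite alphabet) is a rational transduction of the identity language φ⁻¹({1}), then L is also a rational transduction of the identity language ψ⁻¹({1}). -/
/-- `K ⊆ B*` is a rational transduction of `L ⊆ A*` (Nivat's characterization):
there are a finite alphabet `Z`, a regular language `R ⊆ Z*` and monoid
homomorphisms `α : Z* → A*`, `β : Z* → B*` with `K = β(α⁻¹(L) ∩ R)`. -/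
def IsRatTransOf {A B : Type*} (L : Set (FreeMonoid A)) (K : Set (FreeMonoid B)) : Prop :=
  ∃ (Z : Type) (_ : Fintype Z) (R : Language Z)
    (α : FreeMonoid Z →* FreeMonoid A) (β : FreeMonoid Z →* FreeMonoid B),
    R.IsRegular ∧ K = β '' (α ⁻¹' L ∩ (R : Set (FreeMonoid Z)))

/-- If a language `L` is a rational transduction of the identity language of `M`
with respect to one finite generating set (surjective homomorphism from a free
monoid on a finite alphabet), then it is a rational transduction of the identity
language of `M` with respect to any other. -/
theorem identityLanguage_ratTrans_indep_of_genSet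
    {M : Type*} [Monoid M] {X Y Sg : Type} [Fintype X] [Fintype Y] [Fintype Sg]
    (φ : FreeMonoid X →* M) (ψ : FreeMonoid Y →* M)
    (hφ : Function.Surjective φ) (hψ : Function.Surjective ψ)
    (L : Set (FreeMonoid Sg)) (h : IsRatTransOf (φ ⁻¹' {1}) L) :
    IsRatTransOf (ψ ⁻¹' {1}) L := by
  obtain ⟨Z, hZ, R, α, β, hR, hL⟩ := h
  choose g hg using fun x : X => hψ (φ (FreeMonoid.of x))
  have hcomp : ψ.comp (FreeMonoid.lift g) = φ := by
    apply FreeMonoid.hom_eq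
    intro x
    simp [hg]
  refine ⟨Z, hZ, R, (FreeMonoid.lift g).comp α, β, hR, ?_⟩
  have hpre : ((FreeMonoid.lift g).comp α) ⁻¹' (ψ ⁻¹' {1}) = α ⁻¹' (φ ⁻¹' {1}) := by
    rw [← hcomp]
    rfl
  rw [hpre]
  exact hL
end

section
/- Let M₁, …, Mₙ be monoids with surjective monoid homomorphisms φᵢ : Xᵢ* → Mᵢ from free monoids on finite alphabets Xᵢ. Let X be the disjoint union of X₁, …, Xₙ and let φ : X* → M₁ × ⋯ × Mₙ be the monoid homomorphism sending a letter x ∈ Xᵢ to the tuple with φᵢ(x) in the i-th coordinate and the identity in all other coordinates (φ is surjective). Then a language L ⊆ Σ* is a rational transduction of the identity language φ⁻¹({1}) of M₁ × ⋯ × Mₙ if and only if there exist a finite alphabet Ω, an alphabetic monoid homomorphism h : Ω* → Σ*, and languages L₁, …, Lₙ ⊆ Ω*, where each Lᵢ is a rational transduction of the identity language φᵢ⁻¹({1}) of Mᵢ, such that L = h(L₁ ∩ ⋯ ∩ Lₙ). -/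
/-- A homomorphism of free monoids is alphabetic if it sends each letter to a
letter or to the empty word. -/
def IsAlphabetic {A B : Type*} (h : FreeMonoid A →* FreeMonoid B) : Prop :=
  ∀ a : A, (FreeMonoid.toList (h (FreeMonoid.of a))).length ≤ 1

namespace RatTransProd

open FreeMonoid

theorem regular_congr {A : Type} {K L : Set (List A)} (hK : Language.IsRegular K)
    (h : ∀ w, w ∈ L ↔ w ∈ K) : Language.IsRegular L := by
  have : L = K := Set.ext h
  rw [this]
  exact hK

/-- Inverse homomorphic images of regular languages are regular. -/
theorem regular_comap {A B : Type} (f : FreeMonoid A →* FreeMonoid B) {R : Language B}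
    (hR : R.IsRegular) :
    Language.IsRegular ({w : List A | toList (f (ofList w)) ∈ R} : Set (List A)) := by
  obtain ⟨σ, hσ, D, rfl⟩ := hR
  let D' : DFA A σ := ⟨fun s a => D.evalFrom s (toList (f (of a))), D.start, D.accept⟩
  have key : ∀ (w : List A) (s : σ), D'.evalFrom s w = D.evalFrom s (toList (f (ofList w))) := by
    intro w
    induction w with
    | nil => intro s; simp
    | cons a w ih =>
      intro s
      rw [DFA.evalFrom_cons, ih, ofList_cons, map_mul, toList_mul, DFA.evalFrom_of_append]
  refine ⟨σ, hσ, D', ?_⟩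
  ext w
  change D'.evalFrom D.start w ∈ D.accept ↔ D.evalFrom D.start (toList (f (ofList w))) ∈ D.accept
  rw [key]

theorem regular_univ {A : Type} : Language.IsRegular (Set.univ : Set (List A)) :=
  ⟨Unit, inferInstance, ⟨fun _ _ => (), (), Set.univ⟩, by
    ext w; exact ⟨fun _ => trivial, fun _ => trivial⟩⟩

theorem regular_forall {A ι : Type} [Fintype ι] (R : ι → Set (List A))
    (hR : ∀ i, Language.IsRegular (R i)) :
    Language.IsRegular ({w : List A | ∀ i, w ∈ R i} : Set (List A)) := by
  classical
  have : ∀ s : Finset ι, Language.IsRegular ({w : List A | ∀ i ∈ s, w ∈ R i} : Set (List A)) := by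
    intro s
    induction s using Finset.induction_on with
    | empty =>
      refine regular_congr (regular_univ (A := A)) fun w => ?_
      simp
    | insert a s _ ih =>
      refine regular_congr ((hR a).inf ih) fun w => ?_
      change (∀ i ∈ insert a s, w ∈ R i) ↔ (w ∈ R a ∧ ∀ i ∈ s, w ∈ R i)
      simp
  simpa using this Finset.univ

/-- A language contained in a finite family of languages closed under letter quotients. -/
theorem regular_of_family {A : Type} (F : Set (Set (List A))) (hF : F.Finite)
    (hc : ∀ K ∈ F, ∀ a : A, {w | a :: w ∈ K} ∈ F) (L : Set (List A)) (hL : L ∈ F) :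
    Language.IsRegular L := by
  have := hF.fintype
  let D : DFA A F := ⟨fun K a => ⟨{w | a :: w ∈ K.1}, hc _ K.2 a⟩, ⟨L, hL⟩, {K | [] ∈ K.1}⟩
  have key : ∀ (w : List A) (K : F), [] ∈ (D.evalFrom K w).1 ↔ w ∈ K.1 := by
    intro w
    induction w with
    | nil => intro K; rfl
    | cons a w ih => intro K; rw [DFA.evalFrom_cons, ih]; rfl
  refine Language.isRegular_iff.2 ⟨F, this, D, ?_⟩
  ext w
  exact key w ⟨L, hL⟩

/-- `z ↦ z · β(z)`, marked. -/
def gam {Ω Z : Type} (β : FreeMonoid Z →* FreeMonoid Ω) : FreeMonoid Z →* FreeMonoid (Ω ⊕ Z) :=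
  lift fun z => of (Sum.inr z) * map Sum.inl (β (of z))

/-- Projection to the second alphabet. -/
def del (Ω Z : Type) : FreeMonoid (Ω ⊕ Z) →* FreeMonoid Z :=
  lift (Sum.elim (fun _ => 1) of)

/-- Projection to the first alphabet. -/
def pOm (Ω Z : Type) : FreeMonoid (Ω ⊕ Z) →* FreeMonoid Ω :=
  lift (Sum.elim of (fun _ => 1))

theorem del_map_inl {Ω Z : Type} (x : FreeMonoid Ω) : del Ω Z (map Sum.inl x) = 1 := by
  have : (del Ω Z).comp (map Sum.inl) = 1 := hom_eq fun _ => rfl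
  exact DFunLike.congr_fun this x

theorem pOm_map_inl {Ω Z : Type} (x : FreeMonoid Ω) : pOm Ω Z (map Sum.inl x) = x := by
  have : (pOm Ω Z).comp (map Sum.inl) = MonoidHom.id _ := hom_eq fun _ => rfl
  exact DFunLike.congr_fun this x

theorem del_gam {Ω Z : Type} (β : FreeMonoid Z →* FreeMonoid Ω) (v : FreeMonoid Z) :
    del Ω Z (gam β v) = v := by
  have : (del Ω Z).comp (gam β) = MonoidHom.id _ := hom_eq fun z => by
    simp only [MonoidHom.comp_apply, gam, lift_eval_of, map_mul, del_map_inl]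
    simp [del]
  exact DFunLike.congr_fun this v

theorem pOm_gam {Ω Z : Type} (β : FreeMonoid Z →* FreeMonoid Ω) (v : FreeMonoid Z) :
    pOm Ω Z (gam β v) = β v := by
  have : (pOm Ω Z).comp (gam β) = β := hom_eq fun z => by
    simp only [MonoidHom.comp_apply, gam, lift_eval_of, map_mul, pOm_map_inl]
    simp [pOm]
  exact DFunLike.congr_fun this v

/-- `b · γ(Z*)`. -/
def bG {Ω Z : Type} (β : FreeMonoid Z →* FreeMonoid Ω) (b : List Ω) : Set (List (Ω ⊕ Z)) :=
  {w | ∃ v : FreeMonoid Z, w = b.map Sum.inl ++ toList (gam β v)}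

theorem gam_of_mul {Ω Z : Type} (β : FreeMonoid Z →* FreeMonoid Ω) (z : Z) (v : FreeMonoid Z) :
    toList (gam β (of z * v)) =
      Sum.inr z :: ((toList (β (of z))).map Sum.inl ++ toList (gam β v)) := by
  rw [map_mul, toList_mul]
  rfl

theorem regular_gam {Ω Z : Type} [Fintype Z] (β : FreeMonoid Z →* FreeMonoid Ω) :
    Language.IsRegular ({w | ∃ v : FreeMonoid Z, w = toList (gam β v)} : Set (List (Ω ⊕ Z))) := by
  let S : Set (List Ω) := {[]} ∪ ⋃ z : Z, {b | b <:+ toList (β (of z))}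
  have hS : S.Finite := by
    refine (Set.finite_singleton _).union (Set.finite_iUnion fun z => ?_)
    refine (List.finite_toSet (toList (β (of z))).tails).subset ?_
    intro b hb
    exact (List.mem_tails _ _).2 hb
  have hnil : [] ∈ S := Or.inl rfl
  have htail : ∀ c b, (c :: b) ∈ S → b ∈ S := by
    rintro c b (h | h)
    · simp at h
    · obtain ⟨z, hz⟩ := Set.mem_iUnion.1 h
      exact Or.inr (Set.mem_iUnion.2 ⟨z, (List.suffix_cons c b).trans hz⟩)
  refine regular_of_family ({∅} ∪ bG β '' S) ((Set.finite_singleton _).union (hS.image _)) ?_ _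
    (Or.inr ⟨[], hnil, by simp [bG]⟩)
  rintro K (rfl | ⟨b, hb, rfl⟩) a
  · left; rfl
  · cases b with
    | cons c b =>
      by_cases h : a = Sum.inl c
      · right
        refine ⟨b, htail c b hb, ?_⟩
        ext w
        simp [bG, h]
      · left
        ext w
        simp [bG, h]
    | nil =>
      cases a with
      | inl c =>
        left
        ext w
        simp only [bG, List.map_nil, List.nil_append, Set.mem_ofPred_eq, Set.mem_empty_iff_false,
          iff_false]
        rintro ⟨v, hv⟩
        cases v using FreeMonoid.casesOn with
        | one => simp at hv
        | of_mul z v => rw [gam_of_mul] at hv; simp at hv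
      | inr z =>
        right
        refine ⟨toList (β (of z)), Or.inr (Set.mem_iUnion.2 ⟨z, List.suffix_rfl⟩), ?_⟩
        ext w
        simp only [bG, List.map_nil, List.nil_append, Set.mem_ofPred_eq]
        constructor
        · rintro ⟨v, rfl⟩
          exact ⟨of z * v, (gam_of_mul β z v).symm⟩
        · rintro ⟨v, hv⟩
          cases v using FreeMonoid.casesOn with
          | one => simp at hv
          | of_mul z' v =>
            rw [gam_of_mul] at hv
            simp only [List.cons.injEq, Sum.inr.injEq] at hv
            obtain ⟨rfl, rfl⟩ := hv
            exact ⟨v, rfl⟩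

theorem regular_gam_image {Ω Z : Type} [Fintype Z] (β : FreeMonoid Z →* FreeMonoid Ω)
    {R : Language Z} (hR : R.IsRegular) :
    Language.IsRegular
      ({w | ∃ v : FreeMonoid Z, toList v ∈ R ∧ w = toList (gam β v)} : Set (List (Ω ⊕ Z))) := by
  refine regular_congr ((regular_gam β).inf (regular_comap (del Ω Z) hR)) fun w => ?_
  change (∃ v : FreeMonoid Z, toList v ∈ R ∧ w = toList (gam β v)) ↔
    (∃ v : FreeMonoid Z, w = toList (gam β v)) ∧ toList (del Ω Z (ofList w)) ∈ R
  constructor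
  · rintro ⟨v, hv, rfl⟩
    exact ⟨⟨v, rfl⟩, by rwa [ofList_toList, del_gam]⟩
  · rintro ⟨⟨v, rfl⟩, h⟩
    rw [ofList_toList, del_gam] at h
    exact ⟨v, h, rfl⟩

section Sigma

variable {ι : Type} [DecidableEq ι] {Z : ι → Type}

/-- Projection of words over a disjoint union to one of the alphabets. -/
def sp (i : ι) : FreeMonoid (Σ j, Z j) →* FreeMonoid (Z i) :=
  lift fun p => if h : p.1 = i then of (h ▸ p.2) else 1

theorem sp_map_same (i : ι) (x : FreeMonoid (Z i)) : sp i (map (Sigma.mk i) x) = x := by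
  have : (sp i).comp (map (Sigma.mk i)) = MonoidHom.id (FreeMonoid (Z i)) :=
    hom_eq fun z => by simp [sp]
  exact DFunLike.congr_fun this x

theorem sp_map_ne {i j : ι} (h : j ≠ i) (x : FreeMonoid (Z j)) :
    sp i (map (Sigma.mk j) x) = 1 := by
  have : (sp i).comp (map (Sigma.mk j)) = (1 : FreeMonoid (Z j) →* FreeMonoid (Z i)) :=
    hom_eq fun z => by simp [sp, h]
  exact DFunLike.congr_fun this x

theorem sp_of_same (i : ι) (z : Z i) : sp i (of (⟨i, z⟩ : Σ j, Z j)) = of z :=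
  sp_map_same i (of z)

theorem sp_of_ne {i j : ι} (h : j ≠ i) (z : Z j) : sp i (of (⟨j, z⟩ : Σ j, Z j)) = 1 :=
  sp_map_ne h (of z)

/-- Projection keeping the common alphabet and the `i`-th alphabet. -/
def pr (Ω : Type) (i : ι) : FreeMonoid (Ω ⊕ Σ j, Z j) →* FreeMonoid (Ω ⊕ Z i) :=
  lift (Sum.elim (fun a => of (Sum.inl a)) (fun p => map Sum.inr (sp i (of p))))

theorem pOm_map_inr {Ω Z : Type} (x : FreeMonoid Z) : pOm Ω Z (map Sum.inr x) = 1 := by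
  have : (pOm Ω Z).comp (map Sum.inr) = 1 := hom_eq fun _ => rfl
  exact DFunLike.congr_fun this x

theorem del_map_inr {Ω Z : Type} (x : FreeMonoid Z) : del Ω Z (map Sum.inr x) = x := by
  have : (del Ω Z).comp (map Sum.inr) = MonoidHom.id _ := hom_eq fun _ => rfl
  exact DFunLike.congr_fun this x

theorem pOm_pr {Ω : Type} (i : ι) (w : FreeMonoid (Ω ⊕ Σ j, Z j)) :
    pOm Ω (Z i) (pr Ω i w) = pOm Ω _ w := by
  have : (pOm Ω (Z i)).comp (pr Ω i) = pOm Ω (Σ j, Z j) := hom_eq fun x => by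
    cases x with
    | inl a => rfl
    | inr p => exact pOm_map_inr _
  exact DFunLike.congr_fun this w

theorem shuffle {Ω : Type} [Fintype ι] [Nonempty ι] (N : ℕ) :
    ∀ (s : ∀ i, FreeMonoid (Ω ⊕ Z i)) (u : FreeMonoid Ω),
      (∑ i, (s i).length ≤ N) → (∀ i, pOm Ω (Z i) (s i) = u) →
      ∃ w : FreeMonoid (Ω ⊕ Σ j, Z j), ∀ i, pr Ω i w = s i := by
  induction N with
  | zero =>
    intro s u hN _
    refine ⟨1, fun i => ?_⟩
    have h0 : ∑ i, (s i).length = 0 := by omega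
    have := (Finset.sum_eq_zero_iff.1 h0) i (Finset.mem_univ i)
    rw [length_eq_zero] at this
    rw [this, map_one]
  | succ N ih =>
    intro s u hN hs
    by_cases hex : ∃ i z t, s i = of (Sum.inr z) * t
    · obtain ⟨i, z, t, hi⟩ := hex
      obtain ⟨w, hw⟩ := ih (Function.update s i t) u (by
          have h1 : ∑ j, (s j).length = ∑ j, (Function.update s i t j).length + 1 := by
            rw [← Finset.add_sum_erase _ _ (Finset.mem_univ i),
              ← Finset.add_sum_erase _ (fun j => (Function.update s i t j).length)
                (Finset.mem_univ i)]
            have : ∑ j ∈ Finset.univ.erase i, (Function.update s i t j).length =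
                ∑ j ∈ Finset.univ.erase i, (s j).length :=
              Finset.sum_congr rfl fun j hj => by
                rw [Function.update_of_ne (Finset.ne_of_mem_erase hj)]
            rw [this, Function.update_self, hi, length_mul, length_of]
            omega
          omega) (by
          intro j
          by_cases h : j = i
          · subst h
            rw [Function.update_self, ← hs j, hi, map_mul]
            exact (one_mul _).symm
          · rw [Function.update_of_ne h, hs])
      refine ⟨of (Sum.inr ⟨i, z⟩) * w, fun j => ?_⟩
      rw [map_mul, hw]
      have hpr : pr Ω j (of (Sum.inr ⟨i, z⟩)) = map Sum.inr (sp j (of (⟨i, z⟩ : Σ j, Z j))) := rfl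
      rw [hpr]
      by_cases h : j = i
      · subst h
        rw [Function.update_self, sp_of_same, hi, map_of]
      · rw [Function.update_of_ne h, sp_of_ne (Ne.symm h), map_one, one_mul]
    · push Not at hex
      cases u using FreeMonoid.casesOn with
      | one =>
        refine ⟨1, fun i => ?_⟩
        rw [map_one]
        have h1 := hs i
        have h2 := hex i
        revert h1 h2
        cases s i using FreeMonoid.casesOn with
        | one => intros; rfl
        | of_mul x t =>
          intro h1 h2
          cases x with
          | inl a =>
            rw [map_mul] at h1
            have := congrArg FreeMonoid.length h1
            rw [length_mul, length_one] at this
            have h3 : (pOm Ω (Z i) (of (Sum.inl a))).length = 1 := rfl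
            omega
          | inr z => exact absurd rfl (h2 z t)
      | of_mul a u =>
        have hst : ∀ i, ∃ t, s i = of (Sum.inl a) * t ∧ pOm Ω (Z i) t = u := by
          intro i
          have h1 := hs i
          have h2 := hex i
          revert h1 h2
          cases s i using FreeMonoid.casesOn with
          | one =>
            intro h1
            have := congrArg FreeMonoid.length h1
            rw [map_one, length_mul, length_one, length_of] at this
            omega
          | of_mul x t =>
            intro h1 h2
            cases x with
            | inl b =>
              rw [map_mul] at h1
              have h4 : b :: toList (pOm Ω (Z i) t) = a :: toList u := congrArg toList h1
              obtain ⟨rfl, h5⟩ := List.cons.inj h4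
              exact ⟨t, rfl, toList.injective h5⟩
            | inr z => exact absurd rfl (h2 z t)
        choose t ht htu using hst
        obtain ⟨w, hw⟩ := ih t u (by
          have h1 : ∑ i, (t i).length < ∑ i, (s i).length :=
            Finset.sum_lt_sum_of_nonempty Finset.univ_nonempty fun i _ => by
              rw [ht i, length_mul, length_of]; omega
          omega) htu
        refine ⟨of (Sum.inl a) * w, fun i => ?_⟩
        rw [map_mul, hw, ht]
        rfl

theorem prod_hom {M : ι → Type*} [∀ i, Monoid (M i)] (φ : ∀ i, FreeMonoid (Z i) →* M i)
    (w : FreeMonoid (Σ i, Z i)) (i : ι) :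
    (lift (fun p : Σ i, Z i => Pi.mulSingle p.1 (φ p.1 (of p.2))) :
      FreeMonoid (Σ i, Z i) →* ∀ i, M i) w i = φ i (sp i w) := by
  have : (Pi.evalMonoidHom M i).comp
      (lift (fun p : Σ i, Z i => Pi.mulSingle p.1 (φ p.1 (of p.2))) :
        FreeMonoid (Σ i, Z i) →* ∀ i, M i) = (φ i).comp (sp i) := hom_eq fun p => by
    obtain ⟨j, z⟩ := p
    simp only [MonoidHom.comp_apply, lift_eval_of, Pi.evalMonoidHom_apply]
    by_cases h : j = i
    · subst h
      rw [sp_of_same, Pi.mulSingle_eq_same]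
    · rw [sp_of_ne h, map_one, Pi.mulSingle_eq_of_ne (Ne.symm h)]
  exact DFunLike.congr_fun this w

end Sigma

end RatTransProd

/-- A language is a rational transduction of the identity language of a direct
product `M₁ × ⋯ × Mₙ` iff it is the image under an alphabetic morphism of an
intersection `L₁ ∩ ⋯ ∩ Lₙ` where each `Lᵢ` is a rational transduction of the
identity language of `Mᵢ`. -/
theorem ratTrans_prod_identityLanguage_iff
    {n : ℕ} (hn : 0 < n) (M : Fin n → Type*) [∀ i, Monoid (M i)]
    (X : Fin n → Type) [∀ i, Fintype (X i)]
    (φ : ∀ i, FreeMonoid (X i) →* M i) (hφ : ∀ i, Function.Surjective (φ i))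
    {Sg : Type} [Fintype Sg] (L : Set (FreeMonoid Sg)) :
    IsRatTransOf
      ((FreeMonoid.lift
          (fun p : Σ i, X i => Pi.mulSingle p.1 (φ p.1 (FreeMonoid.of p.2)))
        : FreeMonoid (Σ i, X i) →* ∀ i, M i) ⁻¹' {1}) L ↔
      ∃ (Ω : Type) (_ : Fintype Ω) (h : FreeMonoid Ω →* FreeMonoid Sg),
        IsAlphabetic h ∧
          ∃ L' : Fin n → Set (FreeMonoid Ω),
            (∀ i, IsRatTransOf ((φ i) ⁻¹' {1}) (L' i)) ∧ L = h '' (⋂ i, L' i) := by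
  classical
  have : Nonempty (Fin n) := ⟨⟨0, hn⟩⟩
  constructor
  · rintro ⟨Z, hZ, R, α, β, hR, rfl⟩
    refine ⟨Sg ⊕ Z, inferInstance, RatTransProd.pOm Sg Z, ?_,
      fun i => RatTransProd.gam β ''
        (((RatTransProd.sp i).comp α) ⁻¹' ((φ i) ⁻¹' {1}) ∩ (R : Set (FreeMonoid Z))), ?_, ?_⟩
    · rintro (a | z)
      · exact le_refl 1
      · exact Nat.zero_le 1
    · intro i
      exact ⟨Z, hZ, R, _, _, hR, rfl⟩
    · ext x
      constructor
      · rintro ⟨v, ⟨hv, hvR⟩, rfl⟩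
        refine ⟨RatTransProd.gam β v, Set.mem_iInter.2 fun i => ⟨v, ⟨?_, hvR⟩, rfl⟩,
          RatTransProd.pOm_gam β v⟩
        have := congrFun (show _ = (1 : ∀ i, M i) from hv) i
        rw [RatTransProd.prod_hom] at this
        exact this
      · rintro ⟨y, hy, rfl⟩
        rw [Set.mem_iInter] at hy
        obtain ⟨v, ⟨-, hvR⟩, rfl⟩ := hy ⟨0, hn⟩
        refine ⟨v, ⟨?_, hvR⟩, (RatTransProd.pOm_gam β v).symm⟩
        change _ = (1 : ∀ i, M i)
        funext i
        rw [RatTransProd.prod_hom]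
        obtain ⟨v', ⟨hv', -⟩, he⟩ := hy i
        have := congrArg (RatTransProd.del Sg Z) he
        rw [RatTransProd.del_gam, RatTransProd.del_gam] at this
        subst this
        exact hv'
  · rintro ⟨Ω, hΩ, h, -, L', hL', rfl⟩
    choose Z hZ R α β hR hL using hL'
    let α' : FreeMonoid (Ω ⊕ Σ i, Z i) →* FreeMonoid (Σ i, X i) :=
      FreeMonoid.lift (Sum.elim (fun _ => 1)
        (fun p => FreeMonoid.map (Sigma.mk p.1) (α p.1 (FreeMonoid.of p.2))))
    have hα : ∀ i w, RatTransProd.sp i (α' w) =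
        α i (RatTransProd.del Ω (Z i) (RatTransProd.pr Ω i w)) := by
      intro i w
      have : (RatTransProd.sp i).comp α' =
          (α i).comp ((RatTransProd.del Ω (Z i)).comp (RatTransProd.pr Ω i)) :=
        FreeMonoid.hom_eq fun x => by
          cases x with
          | inl a =>
            change RatTransProd.sp i 1 = α i 1
            rw [map_one, map_one]
          | inr p =>
            obtain ⟨j, z⟩ := p
            change RatTransProd.sp i (FreeMonoid.map (Sigma.mk j) (α j (FreeMonoid.of z))) =
              α i (RatTransProd.del Ω (Z i)
                (FreeMonoid.map Sum.inr (RatTransProd.sp i (FreeMonoid.of ⟨j, z⟩))))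
            rw [RatTransProd.del_map_inr]
            by_cases hij : j = i
            · subst hij
              rw [RatTransProd.sp_map_same, RatTransProd.sp_of_same]
            · rw [RatTransProd.sp_map_ne hij, RatTransProd.sp_of_ne hij, map_one]
      exact DFunLike.congr_fun this w
    let T : Set (List (Ω ⊕ Σ i, Z i)) := {w | ∀ i, w ∈ {w : List (Ω ⊕ Σ i, Z i) |
      FreeMonoid.toList (RatTransProd.pr Ω i (FreeMonoid.ofList w)) ∈
        ({w | ∃ v : FreeMonoid (Z i), FreeMonoid.toList v ∈ R i ∧
          w = FreeMonoid.toList (RatTransProd.gam (β i) v)} : Set (List (Ω ⊕ Z i)))}}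
    have hT : Language.IsRegular T := RatTransProd.regular_forall _ fun i =>
      RatTransProd.regular_comap (RatTransProd.pr Ω i)
        (RatTransProd.regular_gam_image (β i) (hR i))
    have hTm : ∀ w : FreeMonoid (Ω ⊕ Σ i, Z i), w ∈ (T : Set (FreeMonoid (Ω ⊕ Σ i, Z i))) ↔
        ∀ i, ∃ v : FreeMonoid (Z i), v ∈ (R i : Set (FreeMonoid (Z i))) ∧
          RatTransProd.pr Ω i w = RatTransProd.gam (β i) v := fun w => Iff.rfl
    refine ⟨Ω ⊕ Σ i, Z i, inferInstance, T, α', h.comp (RatTransProd.pOm Ω _), hT, ?_⟩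
    ext x
    constructor
    · rintro ⟨u, hu, rfl⟩
      rw [Set.mem_iInter] at hu
      have hu' : ∀ i, ∃ v : FreeMonoid (Z i), φ i (α i v) = 1 ∧
          v ∈ (R i : Set (FreeMonoid (Z i))) ∧ β i v = u := by
        intro i
        have := hu i
        rw [hL i] at this
        obtain ⟨v, ⟨h1, h2⟩, h3⟩ := this
        exact ⟨v, h1, h2, h3⟩
      choose v h1 h2 h3 using hu'
      obtain ⟨w, hw⟩ := RatTransProd.shuffle _ (fun i => RatTransProd.gam (β i) (v i)) u le_rfl
        (fun i => by rw [RatTransProd.pOm_gam, h3])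
      refine ⟨w, ⟨?_, (hTm w).2 fun i => ⟨v i, h2 i, hw i⟩⟩, ?_⟩
      · change _ = (1 : ∀ i, M i)
        funext i
        rw [RatTransProd.prod_hom, hα, hw, RatTransProd.del_gam, h1]
        rfl
      · rw [MonoidHom.comp_apply, ← RatTransProd.pOm_pr ⟨0, hn⟩, hw, RatTransProd.pOm_gam, h3]
    · rintro ⟨w, ⟨hw1, hw2⟩, rfl⟩
      refine ⟨RatTransProd.pOm Ω _ w, Set.mem_iInter.2 fun i => ?_, rfl⟩
      obtain ⟨v, hv, hwv⟩ := (hTm w).1 hw2 i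
      rw [hL i]
      refine ⟨v, ⟨?_, hv⟩, ?_⟩
      · have := congrFun (show _ = (1 : ∀ i, M i) from hw1) i
        rw [RatTransProd.prod_hom, hα, hwv, RatTransProd.del_gam] at this
        exact this
      · rw [← RatTransProd.pOm_pr i, hwv, RatTransProd.pOm_gam]
end

section
/- Let M₁ and M₂ be monoids with surjective monoid homomorphisms φ₁ : X₁* → M₁ and φ₂ : X₂* → M₂ from free monoids on finite alphabets, let X be the disjoint union of X₁ and X₂, and let φ : X* → M₁ × M₂ be the surjective monoid homomorphism sending x ∈ X₁ to (φ₁(x), 1) and x ∈ X₂ to (1, φ₂(x)). If L₁ ⊆ Σ* is a rational transduction of φ₁⁻¹({1}) and L₂ ⊆ Σ* is a rational transduction of φ₂⁻¹({1}), then L₁ ∩ L₂ is a rational transduction of φ⁻¹({1}). -/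
namespace RatTransProd

/-- Insert after each letter `z` its output word `f z`. -/
def tau {Z S : Type} (f : Z → List S) : List Z → List (Z ⊕ S)
  | [] => []
  | z :: u => Sum.inl z :: ((f z).map Sum.inr ++ tau f u)

theorem tau_left {Z S : Type} (f : Z → List S) (u : List Z) :
    (tau f u).filterMap Sum.getLeft? = u := by
  induction u with
  | nil => rfl
  | cons z u ih => simp [tau, ih, List.filterMap_cons, List.filterMap_append, List.filterMap_map, Function.comp_def]

theorem tau_right {Z S : Type} (f : Z → List S) (u : List Z) :
    (tau f u).filterMap Sum.getRight? = u.flatMap f := by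
  induction u with
  | nil => rfl
  | cons z u ih => simp [tau, ih, List.filterMap_cons, List.filterMap_append, List.filterMap_map, Function.comp_def]

/-- Residual language: pending output `l`, automaton state `q`. -/
def resid {Z S σ : Type} (f : Z → List S) (M : DFA Z σ) (q : σ) (l : List S) :
    Language (Z ⊕ S) :=
  {v | ∃ u, M.evalFrom q u ∈ M.accept ∧ v = l.map Sum.inr ++ tau f u}

theorem regular_tau {Z S : Type} [Finite Z] [Finite S] (f : Z → List S) {R : Language Z}
    (hR : R.IsRegular) :
    Language.IsRegular ({v | ∃ u, u ∈ R ∧ v = tau f u} : Language (Z ⊕ S)) := by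
  obtain ⟨σ, _, M, rfl⟩ := hR
  obtain ⟨N, hN⟩ : ∃ N, ∀ z, (f z).length ≤ N := by
    obtain ⟨N, hN⟩ := (Set.finite_range fun z => (f z).length).bddAbove
    exact ⟨N, fun z => hN ⟨z, rfl⟩⟩
  let F : Set (Language (Z ⊕ S)) :=
    insert (∅ : Set _) (Set.image2 (resid f M) Set.univ {l | l.length ≤ N})
  have hF : F.Finite :=
    (Set.Finite.image2 _ Set.finite_univ (List.finite_length_le S N)).insert _
  have step : ∀ K ∈ F, ∀ a, K.leftQuotient [a] ∈ F := by
    rintro K (rfl | ⟨q, -, l, hl, rfl⟩) a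
    · left; rfl
    · rcases l with _ | ⟨s', l⟩
      · rcases a with z | s
        · right
          refine ⟨M.step q z, trivial, f z, hN z, ?_⟩
          ext v
          constructor
          · rintro ⟨u, hu, rfl⟩
            exact ⟨z :: u, by simpa using hu, by simp [tau]⟩
          · rintro ⟨u, hu, h⟩
            rcases u with _ | ⟨z', u⟩
            · simp [tau] at h
            · simp only [tau, List.map_nil, List.nil_append, List.cons_append,
                List.cons.injEq, Sum.inl.injEq] at h
              obtain ⟨rfl, rfl⟩ := h
              exact ⟨u, by simpa using hu, rfl⟩
        · left
          ext v
          constructor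
          · rintro ⟨u, hu, h⟩
            rcases u with _ | ⟨z', u⟩ <;> simp [tau] at h
          · intro h; exact h.elim
      · by_cases ha : a = Sum.inr s'
        · subst ha
          right
          refine ⟨q, trivial, l, by simp at hl ⊢; omega, ?_⟩
          ext v
          constructor
          · rintro ⟨u, hu, rfl⟩
            exact ⟨u, hu, by simp⟩
          · rintro ⟨u, hu, h⟩
            exact ⟨u, hu, by simpa using h⟩
        · left
          ext v
          constructor
          · rintro ⟨u, hu, h⟩
            simp at h
            exact (ha h.1).elim
          · intro h; exact h.elim
  apply Language.IsRegular.of_finite_range_leftQuotient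
  apply hF.subset
  rintro _ ⟨x, rfl⟩
  induction x using List.reverseRecOn with
  | nil =>
    right
    exact ⟨M.start, trivial, [], by simp, rfl⟩
  | append_singleton x a ih =>
    exact Eq.mpr (congrArg (fun K => K ∈ F) (Language.leftQuotient_append _ x [a]))
      (step _ ih a)

theorem regular_filterMap {A B : Type} (p : A → Option B) {L : Language B} (hL : L.IsRegular) :
    Language.IsRegular ({w | w.filterMap p ∈ L} : Language A) := by
  apply Language.IsRegular.of_finite_range_leftQuotient
  apply (hL.finite_range_leftQuotient.image
    (fun K : Language B => ({w | w.filterMap p ∈ K} : Language A))).subset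
  rintro _ ⟨x, rfl⟩
  refine ⟨_, ⟨x.filterMap p, rfl⟩, ?_⟩
  ext v
  change x.filterMap p ++ v.filterMap p ∈ L ↔ (x ++ v).filterMap p ∈ L
  rw [List.filterMap_append]

variable {Z₁ Z₂ S : Type}

/-- Erase `Z₂`. -/
def p₁ : Z₁ ⊕ (Z₂ ⊕ S) → Option (Z₁ ⊕ S)
  | .inl z => some (.inl z)
  | .inr (.inl _) => none
  | .inr (.inr s) => some (.inr s)

/-- Erase `Z₁`. -/
def p₂ : Z₁ ⊕ (Z₂ ⊕ S) → Option (Z₂ ⊕ S)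
  | .inl _ => none
  | .inr x => some x

theorem shuffle_s3 (a : List (Z₁ ⊕ S)) : ∀ b : List (Z₂ ⊕ S),
    a.filterMap Sum.getRight? = b.filterMap Sum.getRight? →
    ∃ w : List (Z₁ ⊕ (Z₂ ⊕ S)), w.filterMap p₁ = a ∧ w.filterMap p₂ = b := by
  induction a with
  | nil =>
    intro b
    induction b with
    | nil => intro _; exact ⟨[], rfl, rfl⟩
    | cons y b ih =>
      intro h
      rcases y with z | s
      · obtain ⟨w, h1, h2⟩ := ih (by simpa [List.filterMap_cons] using h)
        exact ⟨.inr (.inl z) :: w, by simpa [p₁, List.filterMap_cons] using h1, by simpa [p₂, List.filterMap_cons] using h2⟩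
      · simp at h
  | cons x a iha =>
    rcases x with z | s
    · intro b h
      obtain ⟨w, h1, h2⟩ := iha b (by simpa [List.filterMap_cons] using h)
      exact ⟨.inl z :: w, by simpa [p₁, List.filterMap_cons] using h1, by simpa [p₂, List.filterMap_cons] using h2⟩
    · intro b
      induction b with
      | nil => intro h; simp at h
      | cons y b ih =>
        intro h
        rcases y with z | s'
        · obtain ⟨w, h1, h2⟩ := ih (by simpa [List.filterMap_cons] using h)
          exact ⟨.inr (.inl z) :: w, by simpa [p₁, List.filterMap_cons] using h1, by simpa [p₂, List.filterMap_cons] using h2⟩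
        · simp at h
          obtain ⟨rfl, h⟩ := h
          obtain ⟨w, h1, h2⟩ := iha b h
          exact ⟨.inr (.inr s) :: w, by simpa [p₁, List.filterMap_cons] using h1, by simpa [p₂, List.filterMap_cons] using h2⟩

theorem hom_flatMap {Z S : Type} (β : FreeMonoid Z →* FreeMonoid S) (u : List Z) :
    (β (FreeMonoid.ofList u)).toList =
      u.flatMap (fun z => (β (FreeMonoid.of z)).toList) := by
  induction u with
  | nil => simp
  | cons z u ih => simp [FreeMonoid.ofList_cons, ih]

/-- The output morphism. -/
def out : FreeMonoid (Z₁ ⊕ (Z₂ ⊕ S)) →* FreeMonoid S :=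
  FreeMonoid.lift (Sum.elim (fun _ => 1) (Sum.elim (fun _ => 1) FreeMonoid.of))

theorem out_one (w : List (Z₁ ⊕ (Z₂ ⊕ S))) :
    (out (FreeMonoid.ofList w)).toList = (w.filterMap p₁).filterMap Sum.getRight? := by
  induction w with
  | nil => simp
  | cons x w ih =>
    rw [FreeMonoid.ofList_cons, map_mul, FreeMonoid.toList_mul, ih]
    rcases x with z | z | s <;> simp [out, p₁, List.filterMap_cons]

theorem out_two (w : List (Z₁ ⊕ (Z₂ ⊕ S))) :
    (out (FreeMonoid.ofList w)).toList = (w.filterMap p₂).filterMap Sum.getRight? := by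
  induction w with
  | nil => simp
  | cons x w ih =>
    rw [FreeMonoid.ofList_cons, map_mul, FreeMonoid.toList_mul, ih]
    rcases x with z | z | s <;> simp [out, p₂, List.filterMap_cons]

/-- The input morphism. -/
def inp {X₁ X₂ : Type} (α₁ : FreeMonoid Z₁ →* FreeMonoid X₁)
    (α₂ : FreeMonoid Z₂ →* FreeMonoid X₂) :
    FreeMonoid (Z₁ ⊕ (Z₂ ⊕ S)) →* FreeMonoid (X₁ ⊕ X₂) :=
  FreeMonoid.lift (Sum.elim (fun z => FreeMonoid.map Sum.inl (α₁ (FreeMonoid.of z)))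
    (Sum.elim (fun z => FreeMonoid.map Sum.inr (α₂ (FreeMonoid.of z))) (fun _ => 1)))

section
variable {M₁ M₂ : Type*} [Monoid M₁] [Monoid M₂] {X₁ X₂ : Type}
    (φ₁ : FreeMonoid X₁ →* M₁) (φ₂ : FreeMonoid X₂ →* M₂)

/-- The product morphism. -/
abbrev prodHom : FreeMonoid (X₁ ⊕ X₂) →* M₁ × M₂ :=
  FreeMonoid.lift
          (Sum.elim (fun x : X₁ => ((φ₁ (FreeMonoid.of x), 1) : M₁ × M₂))
            (fun x : X₂ => ((1, φ₂ (FreeMonoid.of x)) : M₁ × M₂)))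

theorem prodHom_inl (u : FreeMonoid X₁) :
    prodHom φ₁ φ₂ (FreeMonoid.map Sum.inl u) = (φ₁ u, 1) := by
  have : (prodHom φ₁ φ₂).comp (FreeMonoid.map Sum.inl) = (MonoidHom.inl M₁ M₂).comp φ₁ :=
    FreeMonoid.hom_eq fun x => by simp
  exact DFunLike.congr_fun this u

theorem prodHom_inr (u : FreeMonoid X₂) :
    prodHom φ₁ φ₂ (FreeMonoid.map Sum.inr u) = (1, φ₂ u) := by
  have : (prodHom φ₁ φ₂).comp (FreeMonoid.map Sum.inr) = (MonoidHom.inr M₁ M₂).comp φ₂ :=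
    FreeMonoid.hom_eq fun x => by simp
  exact DFunLike.congr_fun this u

theorem prodHom_inp (α₁ : FreeMonoid Z₁ →* FreeMonoid X₁) (α₂ : FreeMonoid Z₂ →* FreeMonoid X₂)
    (w : List (Z₁ ⊕ (Z₂ ⊕ S))) :
    prodHom φ₁ φ₂ (inp α₁ α₂ (FreeMonoid.ofList w)) =
      (φ₁ (α₁ (FreeMonoid.ofList ((w.filterMap p₁).filterMap Sum.getLeft?))),
       φ₂ (α₂ (FreeMonoid.ofList ((w.filterMap p₂).filterMap Sum.getLeft?)))) := by
  induction w with
  | nil => simp; rfl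
  | cons x w ih =>
    rw [FreeMonoid.ofList_cons, map_mul, map_mul, ih]
    rcases x with z | z | s
    · rw [show inp α₁ α₂ (FreeMonoid.of (Sum.inl z : Z₁ ⊕ (Z₂ ⊕ S))) =
        FreeMonoid.map Sum.inl (α₁ (FreeMonoid.of z)) from rfl, prodHom_inl]
      simp [p₁, p₂, List.filterMap_cons, FreeMonoid.ofList_cons]
    · rw [show inp α₁ α₂ (FreeMonoid.of (Sum.inr (Sum.inl z) : Z₁ ⊕ (Z₂ ⊕ S))) =
        FreeMonoid.map Sum.inr (α₂ (FreeMonoid.of z)) from rfl, prodHom_inr]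
      simp [p₁, p₂, List.filterMap_cons, FreeMonoid.ofList_cons]
    · rw [show inp α₁ α₂ (FreeMonoid.of (Sum.inr (Sum.inr s) : Z₁ ⊕ (Z₂ ⊕ S))) = 1 from rfl]
      simp [p₁, p₂, List.filterMap_cons]

end

end RatTransProd


/-- If `L₁` is a rational transduction of the identity language of `M₁` and `L₂`
is a rational transduction of the identity language of `M₂`, then `L₁ ∩ L₂` is a
rational transduction of the identity language of `M₁ × M₂`. -/
theorem inter_ratTrans_prod_identityLanguage
    {M₁ M₂ : Type*} [Monoid M₁] [Monoid M₂] {X₁ X₂ Sg : Type}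
    [Fintype X₁] [Fintype X₂] [Fintype Sg]
    (φ₁ : FreeMonoid X₁ →* M₁) (φ₂ : FreeMonoid X₂ →* M₂)
    (hφ₁ : Function.Surjective φ₁) (hφ₂ : Function.Surjective φ₂)
    (L₁ L₂ : Set (FreeMonoid Sg))
    (h₁ : IsRatTransOf (φ₁ ⁻¹' {1}) L₁) (h₂ : IsRatTransOf (φ₂ ⁻¹' {1}) L₂) :
    IsRatTransOf
      ((FreeMonoid.lift
          (Sum.elim (fun x : X₁ => ((φ₁ (FreeMonoid.of x), 1) : M₁ × M₂))
            (fun x : X₂ => ((1, φ₂ (FreeMonoid.of x)) : M₁ × M₂)))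
        : FreeMonoid (X₁ ⊕ X₂) →* M₁ × M₂) ⁻¹' {1})
      (L₁ ∩ L₂) := by
  classical
  obtain ⟨Z₁, _, R₁, α₁, β₁, hR₁, rfl⟩ := h₁
  obtain ⟨Z₂, _, R₂, α₂, β₂, hR₂, rfl⟩ := h₂
  let f₁ : Z₁ → List Sg := fun z => (β₁ (FreeMonoid.of z)).toList
  let f₂ : Z₂ → List Sg := fun z => (β₂ (FreeMonoid.of z)).toList
  let T₁ : Language (Z₁ ⊕ Sg) := {v | ∃ u, u ∈ R₁ ∧ v = RatTransProd.tau f₁ u}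
  let T₂ : Language (Z₂ ⊕ Sg) := {v | ∃ u, u ∈ R₂ ∧ v = RatTransProd.tau f₂ u}
  let P₁ : Language (Z₁ ⊕ (Z₂ ⊕ Sg)) := {w | w.filterMap RatTransProd.p₁ ∈ T₁}
  let P₂ : Language (Z₁ ⊕ (Z₂ ⊕ Sg)) := {w | w.filterMap RatTransProd.p₂ ∈ T₂}
  refine ⟨Z₁ ⊕ (Z₂ ⊕ Sg), inferInstance, P₁ ⊓ P₂, RatTransProd.inp α₁ α₂, RatTransProd.out,
    (RatTransProd.regular_filterMap _ (RatTransProd.regular_tau f₁ hR₁)).inf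
      (RatTransProd.regular_filterMap _ (RatTransProd.regular_tau f₂ hR₂)), ?_⟩
  ext y
  constructor
  · rintro ⟨⟨u₁, ⟨ha₁, hu₁⟩, hy₁⟩, ⟨u₂, ⟨ha₂, hu₂⟩, hy₂⟩⟩
    have e₁ : y.toList = u₁.toList.flatMap f₁ := by
      rw [← hy₁]; exact RatTransProd.hom_flatMap β₁ u₁.toList
    have e₂ : y.toList = u₂.toList.flatMap f₂ := by
      rw [← hy₂]; exact RatTransProd.hom_flatMap β₂ u₂.toList
    obtain ⟨w, h1, h2⟩ := RatTransProd.shuffle_s3 (RatTransProd.tau f₁ u₁.toList)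
      (RatTransProd.tau f₂ u₂.toList) (by
        rw [RatTransProd.tau_right, RatTransProd.tau_right, ← e₁, ← e₂])
    refine ⟨FreeMonoid.ofList w, ⟨?_, ⟨u₁, hu₁, h1⟩, ⟨u₂, hu₂, h2⟩⟩, ?_⟩
    · change RatTransProd.prodHom φ₁ φ₂ _ = 1
      rw [RatTransProd.prodHom_inp, h1, h2, RatTransProd.tau_left, RatTransProd.tau_left]
      exact Prod.ext ha₁ ha₂
    · apply FreeMonoid.toList.injective
      rw [RatTransProd.out_one, h1, RatTransProd.tau_right, e₁]
  · rintro ⟨w, ⟨ha, ⟨u₁, hu₁, h1⟩, ⟨u₂, hu₂, h2⟩⟩, rfl⟩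
    have ha' : RatTransProd.prodHom φ₁ φ₂
      (RatTransProd.inp α₁ α₂ (FreeMonoid.ofList w.toList)) = 1 := ha
    have h1' : w.toList.filterMap RatTransProd.p₁ = RatTransProd.tau f₁ u₁ := h1
    have h2' : w.toList.filterMap RatTransProd.p₂ = RatTransProd.tau f₂ u₂ := h2
    rw [RatTransProd.prodHom_inp, h1', h2', RatTransProd.tau_left, RatTransProd.tau_left] at ha'
    refine ⟨⟨FreeMonoid.ofList u₁, ⟨congrArg Prod.fst ha', hu₁⟩, ?_⟩,
      ⟨FreeMonoid.ofList u₂, ⟨congrArg Prod.snd ha', hu₂⟩, ?_⟩⟩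
    · apply FreeMonoid.toList.injective
      rw [RatTransProd.hom_flatMap]
      have := RatTransProd.out_one w.toList
      rw [h1', RatTransProd.tau_right] at this
      exact this.symm
    · apply FreeMonoid.toList.injective
      rw [RatTransProd.hom_flatMap]
      have := RatTransProd.out_two w.toList
      rw [h2', RatTransProd.tau_right] at this
      exact this.symm
end

section
/- For n ≥ 1, let Bₙ be the word problem of the free abelian group ℤⁿ with respect to its standard generators: the language over the 2n-letter alphabet {a₁, a₁⁻¹, …, aₙ, aₙ⁻¹} consisting of all words in which, for each i, the number of occurrences of aᵢ equals the number of occurrences of aᵢ⁻¹. Then a language L ⊆ Σ* is a rational transduction of Bₙ if and only if there exist a finite alphabet Ω, an alphabetic monoid homomorphism h : Ω* → Σ*, and languages L₁, …, Lₙ ⊆ Ω*, each a rational transduction of B₁, such that L = h(L₁ ∩ ⋯ ∩ Lₙ). (Equivalently: a language is recognised by a blind n-counter automaton if and only if it is an alphabetic morphism of an intersection of n languages recognised by blind 1-counter automata.) -/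
/-- The word problem of `ℤⁿ` with respect to its standard generators: words over
the alphabet `Fin n × Bool` (where `(i, true)` is `aᵢ` and `(i, false)` is
`aᵢ⁻¹`) in which, for each `i`, the number of occurrences of `aᵢ` equals the
number of occurrences of `aᵢ⁻¹`. -/
def wordProblemZpow (n : ℕ) : Set (FreeMonoid (Fin n × Bool)) :=
  {w | ∀ i : Fin n,
    (FreeMonoid.toList w).count (i, true) = (FreeMonoid.toList w).count (i, false)}

section Helpers

open FreeMonoid

/-- Preimages of regular languages under homomorphisms are regular. -/
lemma regular_preimage {A B : Type} (f : FreeMonoid A →* FreeMonoid B) {R : Language B}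
    (hR : R.IsRegular) :
    Language.IsRegular ((f ⁻¹' (R : Set (FreeMonoid B)) : Set (FreeMonoid A)) : Language A) := by
  apply Language.IsRegular.of_finite_range_leftQuotient
  refine (hR.finite_range_leftQuotient.image
    (fun Q : Language B => ((f ⁻¹' (Q : Set (FreeMonoid B)) : Set (FreeMonoid A)) : Language A))).subset ?_
  rintro _ ⟨x, rfl⟩
  refine ⟨_, ⟨f x, rfl⟩, ?_⟩
  ext y
  change f x * f y ∈ (R : Set (FreeMonoid B)) ↔ f (ofList x * ofList y) ∈ (R : Set (FreeMonoid B))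
  rw [map_mul]
  exact Iff.rfl

/-- Finite intersections of regular languages are regular. -/
lemma regular_iInter {A ι : Type} [Finite ι] (R : ι → Language A)
    (hR : ∀ i, (R i).IsRegular) :
    Language.IsRegular ((⋂ i, (R i : Set (List A)) : Set (List A)) : Language A) := by
  apply Language.IsRegular.of_finite_range_leftQuotient
  refine ((Set.Finite.pi' fun i => (hR i).finite_range_leftQuotient).image
    (fun Q : ι → Language A => ((⋂ i, (Q i : Set (List A)) : Set (List A)) : Language A))).subset ?_
  rintro _ ⟨x, rfl⟩
  refine ⟨fun i => (R i).leftQuotient x, fun i => ⟨x, rfl⟩, ?_⟩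
  ext y
  change y ∈ (⋂ i, ((R i).leftQuotient x : Set (List A))) ↔ x ++ y ∈ (⋂ i, (R i : Set (List A)))
  exact Set.mem_iInter.trans (Iff.symm Set.mem_iInter)

/-- The coding `z ↦ z β(z)`. -/
def gam {Z W : Type} (β : FreeMonoid Z →* FreeMonoid W) : FreeMonoid Z →* FreeMonoid (W ⊕ Z) :=
  lift fun z => of (Sum.inr z) * map Sum.inl (β (of z))

/-- Projection to the left letters. -/
def prL (W Z : Type) : FreeMonoid (W ⊕ Z) →* FreeMonoid W :=
  lift (Sum.elim of fun _ => 1)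

/-- Projection to the right letters. -/
def prR (W Z : Type) : FreeMonoid (W ⊕ Z) →* FreeMonoid Z :=
  lift (Sum.elim (fun _ => 1) of)

lemma prL_map_inl {W Z : Type} (w : FreeMonoid W) : prL W Z (map Sum.inl w) = w :=
  DFunLike.congr_fun
    (hom_eq (fun _ => rfl) : (prL W Z).comp (map Sum.inl) = MonoidHom.id _) w

lemma prR_map_inl {W Z : Type} (w : FreeMonoid W) : prR W Z (map Sum.inl w) = 1 :=
  DFunLike.congr_fun
    (hom_eq (fun _ => rfl) : (prR W Z).comp (map Sum.inl) = 1) w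

lemma prL_gam {Z W : Type} (β : FreeMonoid Z →* FreeMonoid W) (z : FreeMonoid Z) :
    prL W Z (gam β z) = β z := by
  refine DFunLike.congr_fun (hom_eq (fun x => ?_) : (prL W Z).comp (gam β) = β) z
  simp [gam, prL_map_inl]
  simp [prL]

lemma prR_gam {Z W : Type} (β : FreeMonoid Z →* FreeMonoid W) (z : FreeMonoid Z) :
    prR W Z (gam β z) = z := by
  refine DFunLike.congr_fun (hom_eq (fun x => ?_) : (prR W Z).comp (gam β) = MonoidHom.id _) z
  simp [gam, prR_map_inl]
  simp [prR]

/-- Words of the form `t γ(s)`. -/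
def tailLang {Z W : Type} (β : FreeMonoid Z →* FreeMonoid W) (t : List W) : Language (W ⊕ Z) :=
  {u | ∃ s : FreeMonoid Z, u = t.map Sum.inl ++ toList (gam β s)}

lemma gam_of_mul {Z W : Type} (β : FreeMonoid Z →* FreeMonoid W) (z : Z) (s : FreeMonoid Z) :
    toList (gam β (of z * s)) =
      Sum.inr z :: ((toList (β (of z))).map Sum.inl ++ toList (gam β s)) := by
  simp [gam]

lemma gam_cases {Z W : Type} (β : FreeMonoid Z →* FreeMonoid W) (s : FreeMonoid Z) :
    (s = 1 ∧ toList (gam β s) = []) ∨ ∃ z s', s = of z * s' ∧ toList (gam β s) =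
      Sum.inr z :: ((toList (β (of z))).map Sum.inl ++ toList (gam β s')) := by
  induction s using FreeMonoid.inductionOn' with
  | one => left; simp
  | of_mul z s _ => right; exact ⟨z, s, rfl, gam_of_mul β z s⟩

lemma lang_eq_zero {A : Type} (L : Language A) (h : ∀ y, y ∉ L) : L = 0 := by
  ext y
  exact ⟨fun hy => absurd hy (h y), fun hy => absurd hy (Language.notMem_zero y)⟩

lemma regular_tail {Z W : Type} [Finite Z] (β : FreeMonoid Z →* FreeMonoid W) :
    (tailLang β []).IsRegular := by
  apply Language.IsRegular.of_finite_range_leftQuotient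
  let T : Set (List W) := {[]} ∪ ⋃ z : Z, {t | t <:+ toList (β (of z))}
  have hT : T.Finite := by
    refine (Set.finite_singleton _).union (Set.finite_iUnion fun z => ?_)
    refine (List.finite_toSet (toList (β (of z))).tails).subset fun t ht => ?_
    simpa using ht
  refine ((Set.finite_singleton (0 : Language (W ⊕ Z))).union
    (hT.image (tailLang β))).subset ?_
  rintro _ ⟨x, rfl⟩
  induction x using List.reverseRecOn with
  | nil => right; exact ⟨[], by simp [T], rfl⟩
  | append_singleton x a ih =>
    rw [Language.leftQuotient_append]
    rcases ih with ih | ⟨t, ht, ih⟩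
    · left
      rw [Set.mem_singleton_iff] at ih
      rw [ih]
      rfl
    · rw [← ih]
      cases t with
      | nil =>
        cases a with
        | inl o =>
          left
          apply lang_eq_zero
          rintro y ⟨s, hs⟩
          rcases gam_cases β s with ⟨_, h⟩ | ⟨z, s', _, h⟩ <;> simp [h] at hs
        | inr z =>
          right
          refine ⟨toList (β (of z)), Or.inr (Set.mem_iUnion.2 ⟨z, List.suffix_rfl⟩), ?_⟩
          ext y
          constructor
          · rintro ⟨s, hs⟩
            exact ⟨of z * s, by rw [gam_of_mul, hs]; rfl⟩
          · rintro ⟨s, hs⟩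
            rcases gam_cases β s with ⟨_, h⟩ | ⟨z', s', _, h⟩
            · simp [h] at hs
            · simp [h] at hs
              obtain ⟨rfl, hs⟩ := hs
              exact ⟨s', hs⟩
      | cons o' t =>
        by_cases hoa : a = Sum.inl o'
        · subst hoa
          right
          refine ⟨t, ?_, ?_⟩
          · rcases ht with ht | ht
            · simp at ht
            · obtain ⟨z, hz⟩ := Set.mem_iUnion.1 ht
              exact Or.inr (Set.mem_iUnion.2 ⟨z, (List.suffix_cons _ _).trans hz⟩)
          · ext y
            constructor
            · rintro ⟨s, hs⟩
              exact ⟨s, by rw [hs]; rfl⟩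
            · rintro ⟨s, hs⟩
              simp at hs
              exact ⟨s, hs⟩
        · left
          apply lang_eq_zero
          rintro y ⟨s, hs⟩
          simp at hs
          exact hoa hs.1

lemma regular_gam {Z W : Type} [Finite Z] (β : FreeMonoid Z →* FreeMonoid W) {R : Language Z}
    (hR : R.IsRegular) :
    Language.IsRegular ((gam β '' (R : Set (FreeMonoid Z)) : Set (FreeMonoid (W ⊕ Z))) :
      Language (W ⊕ Z)) := by
  refine Eq.subst (motive := fun M : Language (W ⊕ Z) => M.IsRegular) ?_
    ((regular_preimage (prR W Z) hR).inf (regular_tail β))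
  ext u
  refine Iff.symm ?_
  constructor
  · rintro ⟨s, hs, rfl⟩
    refine ⟨?_, s, rfl⟩
    change prR W Z (gam β s) ∈ (R : Set (FreeMonoid Z))
    rwa [prR_gam]
  · rintro ⟨hs, s, hu⟩
    have hu' : u = gam β s := hu
    subst hu'
    change prR W Z (gam β s) ∈ (R : Set (FreeMonoid Z)) at hs
    rw [prR_gam] at hs
    exact ⟨s, hs, rfl⟩

/-- Projection to the `i`-th coordinate. -/
def coordP {n : ℕ} (i : Fin n) : FreeMonoid (Fin n × Bool) →* FreeMonoid (Fin 1 × Bool) :=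
  lift fun p => if p.1 = i then of (0, p.2) else 1

lemma count_coordP {n : ℕ} (i : Fin n) (b : Bool) (w : FreeMonoid (Fin n × Bool)) :
    (toList (coordP i w)).count (0, b) = (toList w).count (i, b) := by
  induction w using FreeMonoid.inductionOn' with
  | one => simp
  | of_mul p w ih =>
    obtain ⟨j, c⟩ := p
    rw [map_mul, toList_mul, List.count_append, ih, toList_of_mul, List.count_cons]
    by_cases hj : j = i
    · subst hj
      simp [coordP, List.count_singleton, add_comm]
    · simp [coordP, hj]

lemma mem_wp_iff {n : ℕ} (w : FreeMonoid (Fin n × Bool)) :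
    w ∈ wordProblemZpow n ↔ ∀ i, coordP i w ∈ wordProblemZpow 1 := by
  constructor
  · intro h i j
    obtain rfl : j = 0 := Subsingleton.elim _ _
    rw [count_coordP, count_coordP]
    exact h i
  · intro h i
    have := h i 0
    rwa [count_coordP, count_coordP] at this

/-- Inclusion of the `i`-th coordinate. -/
def coordI {n : ℕ} (i : Fin n) : FreeMonoid (Fin 1 × Bool) →* FreeMonoid (Fin n × Bool) :=
  map fun p => (i, p.2)

lemma coordP_I_same {n : ℕ} (i : Fin n) (w : FreeMonoid (Fin 1 × Bool)) :
    coordP i (coordI i w) = w := by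
  refine DFunLike.congr_fun
    (hom_eq (fun x => ?_) : (coordP i).comp (coordI i) = MonoidHom.id _) w
  obtain ⟨j, b⟩ := x
  obtain rfl : j = 0 := Subsingleton.elim _ _
  simp [coordP, coordI]

lemma coordP_I_ne {n : ℕ} {i j : Fin n} (hij : j ≠ i) (w : FreeMonoid (Fin 1 × Bool)) :
    coordP i (coordI j w) = 1 := by
  refine DFunLike.congr_fun
    (hom_eq (fun x => ?_) : (coordP i).comp (coordI j) = 1) w
  simp [coordP, coordI, hij]

section Shuffle

variable {n : ℕ} {W : Type} {Z : Fin n → Type}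

/-- Projection to the letters of `W` and of `Z i`. -/
def proj (W : Type) (Z : Fin n → Type) (i : Fin n) :
    FreeMonoid (W ⊕ (Σ i, Z i)) →* FreeMonoid (W ⊕ Z i) :=
  lift (Sum.elim (fun o => of (Sum.inl o))
    fun p => if h : p.1 = i then of (Sum.inr (h ▸ p.2)) else 1)

/-- Inclusion of the words over `Z j`. -/
def incl (W : Type) (Z : Fin n → Type) (j : Fin n) :
    FreeMonoid (Z j) →* FreeMonoid (W ⊕ (Σ i, Z i)) :=
  map fun z => Sum.inr ⟨j, z⟩

lemma proj_incl_same (i : Fin n) (s : FreeMonoid (Z i)) :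
    proj W Z i (incl W Z i s) = map Sum.inr s := by
  refine DFunLike.congr_fun
    (hom_eq (fun x => ?_) : (proj W Z i).comp (incl W Z i) = map Sum.inr) s
  simp [proj, incl]

lemma proj_incl_ne {i j : Fin n} (hij : j ≠ i) (s : FreeMonoid (Z j)) :
    proj W Z i (incl W Z j s) = 1 := by
  refine DFunLike.congr_fun
    (hom_eq (fun x => ?_) : (proj W Z i).comp (incl W Z j) = 1) s
  simp [proj, incl, hij]

lemma exists_concat (s : ∀ i, FreeMonoid (Z i)) :
    ∃ w, ∀ i, proj W Z i w = map Sum.inr (s i) := by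
  have key : ∀ S : Finset (Fin n), ∃ w, ∀ i, proj W Z i w = if i ∈ S then map Sum.inr (s i) else 1 := by
    intro S
    induction S using Finset.induction with
    | empty => exact ⟨1, by simp⟩
    | insert j S hj ih =>
      obtain ⟨w, hw⟩ := ih
      refine ⟨incl W Z j (s j) * w, fun i => ?_⟩
      rw [map_mul, hw]
      by_cases hij : j = i
      · subst hij
        simp [proj_incl_same, hj]
      · have : i ≠ j := fun h => hij h.symm
        simp [proj_incl_ne hij, this]
  obtain ⟨w, hw⟩ := key Finset.univ
  exact ⟨w, by simpa using hw⟩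

lemma split_one {W Z : Type} (u : FreeMonoid (W ⊕ Z)) (h : prL W Z u = 1) :
    ∃ s, u = map Sum.inr s := by
  induction u using FreeMonoid.inductionOn' with
  | one => exact ⟨1, by simp⟩
  | of_mul x u ih =>
    rw [map_mul] at h
    cases x with
    | inl o =>
      have h' : o :: toList (prL W Z u) = [] := h
      simp at h'
    | inr z =>
      have h' : 1 * prL W Z u = 1 := h
      obtain ⟨s, hs⟩ := ih (by simpa using h')
      exact ⟨of z * s, by rw [map_mul, hs]; rfl⟩

lemma split_cons {W Z : Type} (u : FreeMonoid (W ⊕ Z)) (o : W) (v : FreeMonoid W)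
    (h : prL W Z u = of o * v) :
    ∃ s u', u = map Sum.inr s * (of (Sum.inl o) * u') ∧ prL W Z u' = v := by
  induction u using FreeMonoid.inductionOn' with
  | one =>
    have h' : [] = o :: toList v := h
    simp at h'
  | of_mul x u ih =>
    rw [map_mul] at h
    cases x with
    | inl o' =>
      have h' : o' :: toList (prL W Z u) = o :: toList v := h
      rw [List.cons.injEq] at h'
      obtain ⟨rfl, h'⟩ := h'
      exact ⟨1, u, by simp, h'⟩
    | inr z =>
      have h' : 1 * prL W Z u = of o * v := h
      obtain ⟨s, u', hs, hu'⟩ := ih (by simpa using h')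
      exact ⟨of z * s, u', by rw [map_mul, hs, mul_assoc]; rfl, hu'⟩

lemma exists_shuffle (v : FreeMonoid W) (u : ∀ i, FreeMonoid (W ⊕ Z i))
    (h : ∀ i, prL W (Z i) (u i) = v) : ∃ w, ∀ i, proj W Z i w = u i := by
  induction v using FreeMonoid.inductionOn' generalizing u with
  | one =>
    choose s hs using fun i => split_one (u i) (h i)
    obtain ⟨w, hw⟩ := exists_concat (W := W) s
    exact ⟨w, fun i => (hw i).trans (hs i).symm⟩
  | of_mul o v ih =>
    choose s u' hs hu' using fun i => split_cons (u i) o v (h i)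
    obtain ⟨w, hw⟩ := exists_concat (W := W) s
    obtain ⟨w', hw'⟩ := ih u' hu'
    refine ⟨w * (of (Sum.inl o) * w'), fun i => ?_⟩
    rw [map_mul, map_mul, hw, hw', hs]
    rfl

lemma prL_proj (i : Fin n) (w : FreeMonoid (W ⊕ (Σ i, Z i))) :
    prL W (Z i) (proj W Z i w) = prL W _ w := by
  refine DFunLike.congr_fun
    (hom_eq (fun x => ?_) : (prL W (Z i)).comp (proj W Z i) = prL W _) w
  rcases x with o | ⟨j, z⟩
  · simp [prL, proj]
  · by_cases hj : j = i
    · subst hj; simp [prL, proj]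
    · simp [prL, proj, hj]

/-- The combined counter map. -/
def comb (W : Type) (Z : Fin n → Type) (α : ∀ i, FreeMonoid (Z i) →* FreeMonoid (Fin 1 × Bool)) :
    FreeMonoid (W ⊕ (Σ i, Z i)) →* FreeMonoid (Fin n × Bool) :=
  lift (Sum.elim (fun _ => 1) fun p => coordI p.1 (α p.1 (of p.2)))

lemma coordP_comb (α : ∀ i, FreeMonoid (Z i) →* FreeMonoid (Fin 1 × Bool)) (i : Fin n)
    (w : FreeMonoid (W ⊕ (Σ i, Z i))) :
    coordP i (comb W Z α w) = α i (prR W (Z i) (proj W Z i w)) := by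
  refine DFunLike.congr_fun
    (hom_eq (fun x => ?_) : (coordP i).comp (comb W Z α) =
      (α i).comp ((prR W (Z i)).comp (proj W Z i))) w
  rcases x with o | ⟨j, z⟩
  · simp [prR, proj, comb]
  · by_cases hj : j = i
    · subst hj; simp [prR, proj, comb, coordP_I_same]
    · simp [prR, proj, comb, hj, coordP_I_ne hj]

end Shuffle

end Helpers

/-- A language is a rational transduction of the word problem `Bₙ` of `ℤⁿ` iff
it is the image under an alphabetic morphism of an intersection of `n` languages
each of which is a rational transduction of the word problem `B₁` of `ℤ`:
equivalently, a language is recognised by a blind `n`-counter automaton iff it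
is an alphabetic morphism of the intersection of `n` languages recognised by
blind `1`-counter automata. -/
theorem ratTrans_wordProblemZpow_iff
    {n : ℕ} (hn : 1 ≤ n) {Sg : Type} [Fintype Sg] (L : Set (FreeMonoid Sg)) :
    IsRatTransOf (wordProblemZpow n) L ↔
      ∃ (Ω : Type) (_ : Fintype Ω) (h : FreeMonoid Ω →* FreeMonoid Sg),
        IsAlphabetic h ∧
          ∃ L' : Fin n → Set (FreeMonoid Ω),
            (∀ i, IsRatTransOf (wordProblemZpow 1) (L' i)) ∧ L = h '' (⋂ i, L' i) := by
  constructor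
  · rintro ⟨Z, _, R, α, β, hR, rfl⟩
    refine ⟨Sg ⊕ Z, inferInstance, prL Sg Z, ?_,
      fun i => gam β '' (((coordP i).comp α) ⁻¹' wordProblemZpow 1 ∩ (R : Set (FreeMonoid Z))),
      fun i => ⟨Z, inferInstance, R, (coordP i).comp α, gam β, hR, rfl⟩, ?_⟩
    · rintro (s | z)
      · simp [prL]
      · simp [prL]
    · ext v
      constructor
      · rintro ⟨r, ⟨hr, hrR⟩, rfl⟩
        refine ⟨gam β r, Set.mem_iInter.2 fun i => ⟨r, ⟨?_, hrR⟩, rfl⟩, prL_gam β r⟩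
        exact (mem_wp_iff _).1 hr i
      · rintro ⟨u, hu, rfl⟩
        rw [Set.mem_iInter] at hu
        obtain ⟨r, ⟨_, hrR⟩, rfl⟩ := hu ⟨0, hn⟩
        refine ⟨r, ⟨(mem_wp_iff _).2 fun i => ?_, hrR⟩, (prL_gam β r).symm⟩
        obtain ⟨r', ⟨hr', _⟩, he⟩ := hu i
        have : r' = r := by rw [← prR_gam β r', he, prR_gam]
        subst this
        exact hr'
  · rintro ⟨W, _, h, -, L', hL', rfl⟩
    choose Z hZ R α β hR hL using hL'
    refine ⟨W ⊕ (Σ i, Z i), inferInstance, (⋂ i, (proj W Z i ⁻¹' (gam (β i) '' (R i : Set (FreeMonoid (Z i)))) : Set (FreeMonoid (W ⊕ (Σ i, Z i)))) : Set (FreeMonoid (W ⊕ (Σ i, Z i)))), comb W Z α,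
      h.comp (prL W _), ?_, ?_⟩
    · exact regular_iInter _ fun i => regular_preimage (proj W Z i) (regular_gam (β i) (hR i))
    · ext x
      constructor
      · rintro ⟨v, hv, rfl⟩
        rw [Set.mem_iInter] at hv
        simp only [hL] at hv
        choose r hr hrv using hv
        obtain ⟨w, hw⟩ := exists_shuffle v (fun i => gam (β i) (r i))
          (fun i => by rw [prL_gam, hrv])
        refine ⟨w, ⟨(mem_wp_iff _).2 fun i => ?_,
          Set.mem_iInter.2 fun i => ⟨r i, (hr i).2, (hw i).symm⟩⟩, ?_⟩
        · rw [coordP_comb, hw, prR_gam]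
          exact (hr i).1
        · rw [MonoidHom.comp_apply, ← prL_proj ⟨0, hn⟩, hw, prL_gam, hrv]
      · rintro ⟨w, ⟨hw, hwR⟩, rfl⟩
        have hwR' := Set.mem_iInter.1 hwR
        refine ⟨prL W _ w, Set.mem_iInter.2 fun i => ?_, rfl⟩
        obtain ⟨r, hr, hrw⟩ := hwR' i
        rw [hL]
        refine ⟨r, ⟨?_, hr⟩, ?_⟩
        · have := (mem_wp_iff _).1 hw i
          rw [coordP_comb, ← hrw, prR_gam] at this
          exact this
        · rw [← prL_proj i, ← hrw, prL_gam]
end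

section
/- A language L ⊆ Σ* over a finite alphabet Σ is context-free if and only if L is a rational transduction of the two-sided Dyck language on two letters, i.e., of the word problem of the free group of rank 2 (the set of words over the four-letter alphabet {a, a⁻¹, b, b⁻¹} that represent the identity element of the free group on {a, b}). -/
/-- The two-sided Dyck language over the alphabet `X × Bool` (`(x, true)` is the
letter `x` and `(x, false)` is `x⁻¹`): the set of words representing the identity
of the free group `F(X)`, i.e. the word problem of `F(X)`. -/
def twoSidedDyck (X : Type*) : Set (FreeMonoid (X × Bool)) :=
  {w | FreeGroup.mk w = 1}


namespace CSProof

/-- Balanced words for the two-sided Dyck language. -/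
inductive Dyck {X : Type} : List (X × Bool) → Prop
  | nil : Dyck []
  | wrap (x : X) (b : Bool) {u : List (X × Bool)} : Dyck u → Dyck ((x, b) :: (u ++ [(x, !b)]))
  | append {u v : List (X × Bool)} : Dyck u → Dyck v → Dyck (u ++ v)

theorem Dyck.insert {X : Type} {w : List (X × Bool)} (h : Dyck w) (x : X) (b : Bool) :
    ∀ s t : List (X × Bool), w = s ++ t → Dyck (s ++ (x, b) :: (x, !b) :: t) := by
  have base : Dyck [(x, b), (x, !b)] := Dyck.wrap x b Dyck.nil
  induction h with
  | nil =>
    intro s t h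
    obtain ⟨rfl, rfl⟩ := List.append_eq_nil_iff.1 h.symm
    exact base
  | @append u v hu hv ihu ihv =>
    intro s t h
    rcases List.append_eq_append_iff.1 h with ⟨c, rfl, rfl⟩ | ⟨c, rfl, rfl⟩
    · have := Dyck.append hu (ihv c t rfl)
      simpa using this
    · have := Dyck.append (ihu s c rfl) hv
      simpa using this
  | @wrap y c u hu ih =>
    intro s t h
    rcases s with _ | ⟨a, s⟩
    · simp only [List.nil_append] at h
      subst h
      simpa using Dyck.append base (Dyck.wrap y c hu)
    · rcases List.eq_nil_or_concat t with rfl | ⟨t, d, rfl⟩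
      · rw [List.append_nil] at h
        rw [← h]
        exact Dyck.append (Dyck.wrap y c hu) base
      · simp only [List.concat_eq_append, List.cons_append, List.cons.injEq] at h
        obtain ⟨rfl, h⟩ := h
        rw [← List.append_assoc] at h
        obtain ⟨h1, h2⟩ := List.append_inj' h rfl
        have := Dyck.wrap y c (ih s t h1)
        rw [List.concat_eq_append, ← h2]
        simpa using this

theorem dyck_of_mk {X : Type} {w : List (X × Bool)} (h : FreeGroup.mk w = 1) : Dyck w := by
  have hr : FreeGroup.Red w [] := by
    rw [FreeGroup.one_eq_mk, FreeGroup.Red.exact] at h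
    obtain ⟨c, h1, h2⟩ := h
    rw [FreeGroup.Red.nil_iff] at h2
    rwa [h2] at h1
  clear h
  induction hr using Relation.ReflTransGen.head_induction_on with
  | refl => exact Dyck.nil
  | head h _ ih =>
    cases h with
    | not => exact ih.insert _ _ _ _ rfl

/-- The singleton language of a letter. -/
def letter {T : Type} (a : T) : Language T := ({[a]} : Set (List T))

/-- Interpretation of symbols by languages. -/
def evs {T N : Type} (I : N → Language T) : List (Symbol T N) → Language T
  | [] => 1
  | Symbol.terminal a :: s => letter a * evs I s
  | Symbol.nonterminal A :: s => I A * evs I s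

theorem evs_append {T N : Type} (I : N → Language T) (s t : List (Symbol T N)) :
    evs I (s ++ t) = evs I s * evs I t := by
  induction s with
  | nil => simp [evs]
  | cons x s ih => cases x <;> simp [evs, ih, mul_assoc]

theorem mem_evs_terminal {T N : Type} (I : N → Language T) (o : List T) :
    o ∈ evs I (o.map Symbol.terminal) := by
  induction o with
  | nil => exact Language.nil_mem_one
  | cons a o ih => exact Language.mem_mul.2 ⟨[a], rfl, o, ih, rfl⟩

theorem eq_of_mem_evs_terminal {T N : Type} (I : N → Language T) (o : List T) :
    ∀ w, w ∈ evs I (o.map Symbol.terminal) → w = o := by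
  induction o with
  | nil => intro w h; exact h
  | cons a o ih =>
    intro w h
    obtain ⟨a', h1, b, h2, rfl⟩ := Language.mem_mul.1 h
    rw [ih b h2, show a' = [a] from h1]; rfl

theorem language_le {T : Type} (g : ContextFreeGrammar T) (I : g.NT → Language T)
    (h : ∀ r ∈ g.rules, ∀ o, o ∈ evs I r.output → o ∈ I r.input) (o : List T)
    (ho : o ∈ g.language) : o ∈ I g.initial := by
  have key : ∀ u v, g.Derives u v → ∀ o, o ∈ evs I v → o ∈ evs I u := by
    intro u v hd
    induction hd with
    | refl => exact fun _ h => h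
    | tail _ hp ih =>
      intro o ho
      apply ih
      obtain ⟨r, hr, hw⟩ := hp
      obtain ⟨p, q, rfl, rfl⟩ := hw.exists_parts
      rw [evs_append, evs_append] at ho ⊢
      obtain ⟨a, ha, b, hb, rfl⟩ := Language.mem_mul.1 ho
      obtain ⟨c, hc, d, hd, rfl⟩ := Language.mem_mul.1 ha
      refine Language.append_mem_mul (Language.append_mem_mul hc ?_) hb
      simpa [evs] using h r hr d hd
  have := key _ _ ho o (mem_evs_terminal I o)
  simpa [evs] using this

section Auto
variable {P X T : Type}

/-- Paths in a labelled graph: `Path E p w o q` reads `w` and outputs `o`. -/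
inductive Path (E : P → Option (X × Bool) → List T → P → Prop) :
    P → List (X × Bool) → List T → P → Prop
  | nil (p : P) : Path E p [] [] p
  | cons {p l o q w o' r} : E p l o q → Path E q w o' r → Path E p (l.toList ++ w) (o ++ o') r

variable {E : P → Option (X × Bool) → List T → P → Prop}

theorem Path.trans {p q r w w' o o'} (h : Path E p w o q) (h' : Path E q w' o' r) :
    Path E p (w ++ w') (o ++ o') r := by
  induction h with
  | nil => exact h'
  | cons e _ ih => simpa using Path.cons e (ih h')

theorem Path.single {p l o q} (h : E p l o q) : Path E p l.toList o q := by
  simpa using Path.cons h (Path.nil q)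

theorem Path.split {p r w o} (h : Path E p w o r) : ∀ u v, w = u ++ v →
    ∃ q o1 o2, o = o1 ++ o2 ∧ Path E p u o1 q ∧ Path E q v o2 r := by
  induction h with
  | nil p =>
    intro u v h
    obtain ⟨rfl, rfl⟩ := List.append_eq_nil_iff.1 h.symm
    exact ⟨p, [], [], rfl, Path.nil p, Path.nil p⟩
  | @cons p l o q w o' r e hp ih =>
    intro u v h
    rcases l with _ | x
    · obtain ⟨q', o1, o2, rfl, h1, h2⟩ := ih u v (by simpa using h)
      exact ⟨q', o ++ o1, o2, by simp, by simpa using Path.cons e h1, h2⟩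
    · rcases u with _ | ⟨y, u⟩
      · simp only [List.nil_append] at h
        subst h
        exact ⟨p, [], o ++ o', rfl, Path.nil p, Path.cons e hp⟩
      · simp only [Option.toList_some, List.cons_append, List.nil_append, List.cons.injEq] at h
        obtain ⟨rfl, rfl⟩ := h
        obtain ⟨q', o1, o2, rfl, h1, h2⟩ := ih u v rfl
        exact ⟨q', o ++ o1, o2, by simp, by simpa using Path.cons e h1, h2⟩

theorem path_closed (C : P → List T → P → Prop)
    (hrefl : ∀ p, C p [] p)
    (htrans : ∀ p q r o o', C p o q → C q o' r → C p (o ++ o') r)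
    (heps : ∀ p o q, E p none o q → C p o q)
    (hwrap : ∀ p p' q' q x b o1 o2 o3, E p (some (x, b)) o1 p' → C p' o2 q' →
      E q' (some (x, !b)) o3 q → C p (o1 ++ o2 ++ o3) q)
    {p w o q} (h : Path E p w o q) (hw : FreeGroup.mk w = 1) : C p o q := by
  have heps' : ∀ p w o q, Path E p w o q → w = [] → C p o q := by
    intro p w o q h
    induction h with
    | nil p => exact fun _ => hrefl p
    | @cons p l o q w o' r e hp ih =>
      intro h
      obtain ⟨h1, h2⟩ := List.append_eq_nil_iff.1 h
      rcases l with _ | x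
      · exact htrans _ _ _ _ _ (heps _ _ _ e) (ih h2)
      · simp at h1
  have hsing : ∀ p w o q, Path E p w o q → ∀ x, w = [x] → ∃ p1 p2 o1 o2 o3, o = o1 ++ o2 ++ o3 ∧
      C p o1 p1 ∧ E p1 (some x) o2 p2 ∧ C p2 o3 q := by
    intro p w o q h
    induction h with
    | nil p => intro x h; simp at h
    | @cons p l o q w o' r e hp ih =>
      intro x h
      rcases l with _ | y
      · obtain ⟨p1, p2, o1, o2, o3, rfl, h1, h2, h3⟩ := ih x (by simpa using h)
        exact ⟨p1, p2, o ++ o1, o2, o3, by simp, htrans _ _ _ _ _ (heps _ _ _ e) h1, h2, h3⟩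
      · simp only [Option.toList_some, List.cons_append, List.nil_append, List.cons.injEq] at h
        obtain ⟨rfl, rfl⟩ := h
        exact ⟨p, q, [], o, o', rfl, hrefl p, e, heps' _ _ _ _ hp rfl⟩
  have hd := dyck_of_mk hw
  clear hw
  induction hd generalizing p o q with
  | nil => exact heps' _ _ _ _ h rfl
  | append _ _ ihu ihv =>
    obtain ⟨q', o1, o2, rfl, h1, h2⟩ := h.split _ _ rfl
    exact htrans _ _ _ _ _ (ihu h1) (ihv h2)
  | @wrap x b u _ ih =>
    obtain ⟨q1, o1, o2, rfl, h1, h2⟩ := h.split [(x, b)] _ rfl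
    obtain ⟨q2, o3, o4, rfl, h3, h4⟩ := h2.split u _ rfl
    obtain ⟨a1, a2, s1, s2, s3, rfl, c1, c2, c3⟩ := hsing _ _ _ _ h1 _ rfl
    obtain ⟨b1, b2, t1, t2, t3, rfl, d1, d2, d3⟩ := hsing _ _ _ _ h4 _ rfl
    have m := htrans _ _ _ _ _ c3 (htrans _ _ _ _ _ (ih h3) d1)
    have := htrans _ _ _ _ _ c1 (htrans _ _ _ _ _ (hwrap _ _ _ _ _ _ _ _ _ c2 m d2) d3)
    simpa using this

/-- The language of a free group automaton. -/
def autoLang (E : P → Option (X × Bool) → List T → P → Prop) (S F : Set P) : Set (List T) :=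
  {o | ∃ s ∈ S, ∃ f ∈ F, ∃ w, FreeGroup.mk w = 1 ∧ Path E s w o f}

end Auto

/-- embedding -/
theorem exists_embedding (X : Type) [Finite X] :
    ∃ φ : FreeGroup X →* FreeGroup (Fin 2), Function.Injective φ := by
  obtain ⟨n, ⟨e⟩⟩ := Finite.exists_equiv_fin X
  let ι : X → ℤ := fun x => ((e x : ℕ) : ℤ)
  have hι : Function.Injective ι := fun x y h => e.injective (Fin.ext (Int.ofNat_inj.1 h))
  let σ : MulAut (FreeGroup ℤ) := FreeGroup.freeGroupCongr (Equiv.addRight (1 : ℤ))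
  let θ : Multiplicative ℤ →* MulAut (FreeGroup ℤ) := zpowersHom _ σ
  let ψ : FreeGroup (Fin 2) →* FreeGroup ℤ ⋊[θ] Multiplicative ℤ :=
    FreeGroup.lift ![SemidirectProduct.inr (Multiplicative.ofAdd 1),
      SemidirectProduct.inl (FreeGroup.of 0)]
  let φ : FreeGroup X →* FreeGroup (Fin 2) := FreeGroup.lift fun x =>
    FreeGroup.of 0 ^ (e x : ℕ) * FreeGroup.of 1 * (FreeGroup.of 0 ^ (e x : ℕ))⁻¹
  have hσ : ∀ k : ℕ, (σ ^ k) (FreeGroup.of 0) = FreeGroup.of (k : ℤ) := by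
    intro k
    induction k with
    | zero => rfl
    | succ k ih =>
      rw [pow_succ', MulAut.mul_apply, ih]
      simp [σ]
  have hcomp : ψ.comp φ = SemidirectProduct.inl.comp (FreeGroup.map ι) := by
    ext1 x
    have h1 : θ (Multiplicative.ofAdd 1) = σ := by simp [θ, zpowersHom_apply]
    simp only [MonoidHom.comp_apply, φ, FreeGroup.lift_apply_of, map_mul, map_pow, map_inv, ψ,
      FreeGroup.map.of, Matrix.cons_val_zero, Matrix.cons_val_one]
    rw [← map_pow, ← map_inv, ← SemidirectProduct.inl_aut, map_pow, h1, hσ]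
  refine ⟨φ, Function.Injective.of_comp (f := ψ) ?_⟩
  rw [← MonoidHom.coe_comp, hcomp]
  exact SemidirectProduct.inl_injective.comp (FreeGroup.map_injective hι)


section ToCF
variable {P X T : Type}

/-- The rules of the triple-construction grammar. -/
inductive IsRule (E : P → Option (X × Bool) → List T → P → Prop) (S F : Set P) :
    ContextFreeRule T (Option (P × P)) → Prop
  | start (s f : P) (hs : s ∈ S) (hf : f ∈ F) : IsRule E S F ⟨none, [.nonterminal (some (s, f))]⟩
  | refl (p : P) : IsRule E S F ⟨some (p, p), []⟩
  | trans (p q r : P) : IsRule E S F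
      ⟨some (p, r), [.nonterminal (some (p, q)), .nonterminal (some (q, r))]⟩
  | eps (p : P) (o : List T) (q : P) (h : E p none o q) : IsRule E S F
      ⟨some (p, q), o.map .terminal⟩
  | wrap (p p' q' q : P) (x : X) (b : Bool) (o o' : List T) (h : E p (some (x, b)) o p')
      (h' : E q' (some (x, !b)) o' q) : IsRule E S F
      ⟨some (p, q), o.map .terminal ++ [.nonterminal (some (p', q'))] ++ o'.map .terminal⟩

theorem finite_rules [Finite P] (E : P → Option (X × Bool) → List T → P → Prop) (S F : Set P)
    (hE : {e : P × Option (X × Bool) × List T × P | E e.1 e.2.1 e.2.2.1 e.2.2.2}.Finite) :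
    {r | IsRule E S F r}.Finite := by
  have h1 := Set.finite_range (fun x : P × P =>
    (⟨none, [.nonterminal (some x)]⟩ : ContextFreeRule T (Option (P × P))))
  have h2 := Set.finite_range (fun p : P =>
    (⟨some (p, p), []⟩ : ContextFreeRule T (Option (P × P))))
  have h3 := Set.finite_range (fun x : P × P × P =>
    (⟨some (x.1, x.2.2), [.nonterminal (some (x.1, x.2.1)), .nonterminal (some (x.2.1, x.2.2))]⟩ :
      ContextFreeRule T (Option (P × P))))
  have h4 := hE.image (fun e =>
    (⟨some (e.1, e.2.2.2), e.2.2.1.map .terminal⟩ : ContextFreeRule T (Option (P × P))))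
  have h5 := (hE.prod hE).image (fun x =>
    (⟨some (x.1.1, x.2.2.2.2), x.1.2.2.1.map .terminal ++
      [.nonterminal (some (x.1.2.2.2, x.2.1))] ++ x.2.2.2.1.map .terminal⟩ :
        ContextFreeRule T (Option (P × P))))
  refine (h1.union (h2.union (h3.union (h4.union h5)))).subset ?_
  intro r hr
  cases hr with
  | start s f => exact Or.inl ⟨(s, f), rfl⟩
  | refl p => exact Or.inr (Or.inl ⟨p, rfl⟩)
  | trans p q r => exact Or.inr (Or.inr (Or.inl ⟨(p, q, r), rfl⟩))
  | eps p o q h => exact Or.inr (Or.inr (Or.inr (Or.inl ⟨(p, none, o, q), h, rfl⟩)))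
  | wrap p p' q' q x b o o' h h' =>
    exact Or.inr (Or.inr (Or.inr (Or.inr
      ⟨((p, some (x, b), o, p'), (q', some (x, !b), o', q)), ⟨h, h'⟩, rfl⟩)))

theorem autoLang_isContextFree [Finite P] (E : P → Option (X × Bool) → List T → P → Prop)
    (S F : Set P)
    (hE : {e : P × Option (X × Bool) × List T × P | E e.1 e.2.1 e.2.2.1 e.2.2.2}.Finite) :
    Language.IsContextFree (autoLang E S F : Language T) := by
  let g : ContextFreeGrammar T := ⟨Option (P × P), none, (finite_rules E S F hE).toFinset⟩
  have hg : ∀ r, r ∈ g.rules ↔ IsRule E S F r := fun r => Set.Finite.mem_toFinset _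
  have prod : ∀ n s, IsRule E S F ⟨n, s⟩ → g.Derives [.nonterminal n] s := fun n s h =>
    Relation.ReflTransGen.single ⟨_, (hg _).2 h, ContextFreeRule.Rewrites.input_output⟩
  refine ⟨g, Language.ext fun o => ⟨fun h => ?_, ?_⟩⟩
  · let I : Option (P × P) → Language T := fun n => match n with
      | none => autoLang E S F
      | some (p, q) => {o | ∃ w, FreeGroup.mk w = 1 ∧ Path E p w o q}
    refine language_le g I ?_ o h
    intro r hr o ho
    cases (hg r).1 hr with
    | start s f hs hf =>
      simp only [evs, mul_one] at ho
      obtain ⟨w, h1, h2⟩ := ho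
      exact ⟨s, hs, f, hf, w, h1, h2⟩
    | refl p =>
      cases ho
      exact ⟨[], rfl, Path.nil p⟩
    | trans p q r =>
      simp only [evs, mul_one] at ho
      obtain ⟨o1, ⟨w1, h1, h1'⟩, o2, ⟨w2, h2, h2'⟩, rfl⟩ := Language.mem_mul.1 ho
      exact ⟨w1 ++ w2, by rw [← FreeGroup.mul_mk, h1, h2, one_mul], h1'.trans h2'⟩
    | eps p o' q h =>
      obtain rfl := eq_of_mem_evs_terminal _ _ _ ho
      exact ⟨_, rfl, Path.single h⟩
    | wrap p p' q' q x b o o' h h' =>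
      simp only [evs_append] at ho
      obtain ⟨o1, ho1, o2, ho2, rfl⟩ := Language.mem_mul.1 ho
      obtain ⟨o3, ho3, o4, ho4, rfl⟩ := Language.mem_mul.1 ho1
      obtain rfl := eq_of_mem_evs_terminal _ _ _ ho2
      obtain rfl := eq_of_mem_evs_terminal _ _ _ ho3
      simp only [evs, mul_one] at ho4
      obtain ⟨w, hw, hp⟩ := ho4
      refine ⟨_, ?_, ((Path.single h).trans hp).trans (Path.single h')⟩
      rw [← FreeGroup.mul_mk, ← FreeGroup.mul_mk, hw, mul_one, FreeGroup.mul_mk]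
      exact (FreeGroup.Red.exact.2 ⟨[], Relation.ReflTransGen.single
        (FreeGroup.Red.Step.not (L₁ := []) (L₂ := [])), Relation.ReflTransGen.refl⟩)
  · rintro ⟨s, hs, f, hf, w, hw, hp⟩
    refine (prod _ _ (IsRule.start s f hs hf)).trans ?_
    refine path_closed (fun p o q => g.Derives [.nonterminal (some (p, q))] (o.map .terminal))
      ?_ ?_ ?_ ?_ hp hw
    · exact fun p => prod _ _ (IsRule.refl p)
    · intro p q r o o' h h'
      refine (prod _ _ (IsRule.trans p q r)).trans ?_
      rw [List.map_append]
      exact (h.append_right [_]).trans (h'.append_left _)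
    · exact fun p o q h => prod _ _ (IsRule.eps p o q h)
    · intro p p' q' q x b o1 o2 o3 h1 h2 h3
      refine (prod _ _ (IsRule.wrap p p' q' q x b o1 o3 h1 h3)).trans ?_
      rw [List.map_append, List.map_append]
      exact (h2.append_left _).append_right _

end ToCF

section FromTrans

variable {Q Z T A : Type}

/-- The graph of a rational transduction. -/
inductive TEdge {X : Type} (M : DFA Z Q) (α : Z → List (X × Bool)) (β : Z → List T) (m : ℕ) :
    (Q × {l : List (X × Bool) // l.length ≤ m}) → Option (X × Bool) → List T →
    (Q × {l : List (X × Bool) // l.length ≤ m}) → Prop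
  | read (q : Q) (z : Z) (l l' : {l : List (X × Bool) // l.length ≤ m}) (h : l.1 = [])
      (h' : l'.1 = α z) : TEdge M α β m (q, l) none (β z) (M.step q z, l')
  | pop (q : Q) (x : X × Bool) (l l' : {l : List (X × Bool) // l.length ≤ m})
      (h : l.1 = x :: l'.1) : TEdge M α β m (q, l) (some x) [] (q, l')

theorem tpath_flush {X : Type} (M : DFA Z Q) (α : Z → List (X × Bool)) (β : Z → List T) (m : ℕ)
    (q : Q) (e : {l : List (X × Bool) // l.length ≤ m}) (he : e.1 = []) :
    ∀ (u : List (X × Bool)) (h : u.length ≤ m), Path (TEdge M α β m) (q, ⟨u, h⟩) u [] (q, e) := by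
  intro u
  induction u with
  | nil =>
    intro h
    have : (⟨[], h⟩ : {l : List (X × Bool) // l.length ≤ m}) = e := Subtype.ext he.symm
    rw [this]
    exact Path.nil _
  | cons x u ih =>
    intro h
    have h' : u.length ≤ m := by simp at h; omega
    exact Path.cons (TEdge.pop (M := M) (α := α) (β := β) q x ⟨x :: u, h⟩ ⟨u, h'⟩ rfl) (ih h')

theorem tpath_run {X : Type} (M : DFA Z Q) (α : Z → List (X × Bool)) (β : Z → List T) (m : ℕ)
    (hm : ∀ z, (α z).length ≤ m)
    (e : {l : List (X × Bool) // l.length ≤ m}) (he : e.1 = []) (zs : List Z) :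
    ∀ (q : Q), Path (TEdge M α β m) (q, e) (zs.flatMap α) (zs.flatMap β) (M.evalFrom q zs, e) := by
  induction zs with
  | nil => exact fun q => Path.nil _
  | cons z zs ih =>
    intro q
    have h1 := Path.single (TEdge.read (M := M) (α := α) (β := β) q z e ⟨α z, hm z⟩ he rfl)
    have := (h1.trans (tpath_flush M α β m _ e he (α z) (hm z))).trans (ih (M.step q z))
    simpa using this

theorem tpath_inv {X : Type} (M : DFA Z Q) (α : Z → List (X × Bool)) (β : Z → List T) (m : ℕ)
    {p w o r} (h : Path (TEdge M α β m) p w o r) (hr : r.2.1 = []) :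
    ∃ zs : List Z, w = p.2.1 ++ zs.flatMap α ∧ o = zs.flatMap β ∧ M.evalFrom p.1 zs = r.1 := by
  induction h with
  | nil p => exact ⟨[], by simp [hr], rfl, rfl⟩
  | cons e _ ih =>
    obtain ⟨zs, rfl, rfl, h⟩ := ih hr
    cases e with
    | read q z l l' h1 h2 =>
      refine ⟨z :: zs, ?_, ?_, ?_⟩
      · simp [h1, h2]
      · simp
      · simpa using h
    | pop q x l l' h1 => exact ⟨zs, by simp [h1], rfl, h⟩

theorem hom_eq_flatMap {B : Type} (α : FreeMonoid Z →* FreeMonoid B) (zs : List Z) :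
    α zs = zs.flatMap (fun z => (α [z] : List B)) := by
  induction zs with
  | nil => exact map_one α
  | cons z zs ih =>
    have h1 : α (z :: zs) = α [z] * α zs := map_mul α (FreeMonoid.of z) zs
    refine h1.trans ?_
    exact congrArg (fun x => α [z] * x) ih

theorem lift_eq_flatMap {B : Type} (f : Z → List B) (zs : List Z) :
    FreeMonoid.lift (M := FreeMonoid B) f zs = zs.flatMap f := by
  refine (hom_eq_flatMap _ zs).trans ?_
  congr 1

theorem isContextFree_of_trans {X : Type} [Finite X] [Finite Z] [Finite Q] (M : DFA Z Q)
    (α : FreeMonoid Z →* FreeMonoid (X × Bool)) (β : FreeMonoid Z →* FreeMonoid T) :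
    Language.IsContextFree (T := T)
      (β '' (α ⁻¹' {w | FreeGroup.mk w = 1} ∩ {w | w ∈ M.accepts})) := by
  let a : Z → List (X × Bool) := fun z => α [z]
  let b : Z → List T := fun z => β [z]
  obtain ⟨m, hm⟩ : ∃ m, ∀ z, (a z).length ≤ m := by
    obtain ⟨m, hm⟩ := (Set.finite_range fun z => (a z).length).bddAbove
    exact ⟨m, fun z => hm ⟨z, rfl⟩⟩
  have hfin : Finite {l : List (X × Bool) // l.length ≤ m} :=
    (List.finite_length_le (X × Bool) m).to_subtype
  let e : {l : List (X × Bool) // l.length ≤ m} := ⟨[], by simp⟩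
  have hcf := autoLang_isContextFree (TEdge M a b m) {(M.start, e)} {x | x.1 ∈ M.accept ∧ x.2 = e} (by
    refine ((Set.finite_univ (α := Q × {l : List (X × Bool) // l.length ≤ m})).prod
      ((Set.finite_univ (α := Option (X × Bool))).prod
      (((Set.finite_range b).union (Set.finite_singleton [])).prod
      (Set.finite_univ (α := Q × {l : List (X × Bool) // l.length ≤ m}))))).subset ?_
    rintro ⟨p, l, o, q⟩ h
    refine ⟨trivial, trivial, ?_, trivial⟩
    cases h with
    | read q z => exact Or.inl ⟨z, rfl⟩
    | pop => exact Or.inr rfl)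
  suffices heq : (β '' (α ⁻¹' {w | FreeGroup.mk w = 1} ∩ {w | w ∈ M.accepts}) : Set (List T)) =
      autoLang (TEdge M a b m) {(M.start, e)} {x | x.1 ∈ M.accept ∧ x.2 = e} from heq ▸ hcf
  apply Set.ext
  intro o
  constructor
  · rintro ⟨zs, ⟨h1, h2⟩, rfl⟩
    refine ⟨_, rfl, (M.eval zs, e), ⟨h2, rfl⟩, α zs, h1, ?_⟩
    have hp := tpath_run M a b m hm e rfl zs M.start
    have e1 : (α zs : List (X × Bool)) = zs.flatMap a := hom_eq_flatMap α zs
    have e2 : (β zs : List T) = zs.flatMap b := hom_eq_flatMap β zs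
    rw [← e1, ← e2] at hp
    exact hp
  · rintro ⟨_, rfl, ⟨q, f⟩, ⟨h1, rfl⟩, w, hw, hp⟩
    obtain ⟨zs, rfl, rfl, h⟩ := tpath_inv M a b m hp rfl
    refine ⟨zs, ⟨?_, ?_⟩, hom_eq_flatMap β zs⟩
    · show FreeGroup.mk (α zs) = 1
      exact (congrArg FreeGroup.mk (hom_eq_flatMap α zs)).trans hw
    · show M.evalFrom M.start zs ∈ M.accept
      rw [show M.evalFrom M.start zs = q from h]; exact h1

end FromTrans

section ToTrans

variable {P X T : Type}

/-- Edges as a type. -/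
abbrev Ed (E : P → Option (X × Bool) → List T → P → Prop) : Type :=
  {e : P × Option (X × Bool) × List T × P // E e.1 e.2.1 e.2.2.1 e.2.2.2}

/-- Sequences of edges forming a path. -/
def EPath (E : P → Option (X × Bool) → List T → P → Prop) : P → List (Ed E) → P → Prop
  | p, [], q => p = q
  | p, e :: es, q => p = e.1.1 ∧ EPath E e.1.2.2.2 es q

/-- The automaton reading edge sequences. -/
def edgeNFA (E : P → Option (X × Bool) → List T → P → Prop) (S F : Set P) : NFA (Ed E) P where
  step p e := {q | p = e.1.1 ∧ q = e.1.2.2.2}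
  start := S
  accept := F

theorem mem_evalFrom_edgeNFA (E : P → Option (X × Bool) → List T → P → Prop) (S F : Set P)
    (es : List (Ed E)) : ∀ (S' : Set P) (q : P),
    q ∈ (edgeNFA E S F).evalFrom S' es ↔ ∃ p ∈ S', EPath E p es q := by
  induction es with
  | nil => intro S' q; simp [EPath]
  | cons e es ih =>
    intro S' q
    rw [NFA.evalFrom_cons, ih]
    constructor
    · rintro ⟨p, hp, h⟩
      obtain ⟨t, ht, h1, rfl⟩ := NFA.mem_stepSet.1 hp
      exact ⟨t, ht, h1, h⟩
    · rintro ⟨p, hp, h1, h⟩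
      exact ⟨_, NFA.mem_stepSet.2 ⟨p, hp, h1, rfl⟩, h⟩

theorem EPath.path {E : P → Option (X × Bool) → List T → P → Prop} (es : List (Ed E)) :
    ∀ {p q}, EPath E p es q →
    Path E p (es.flatMap fun e => e.1.2.1.toList) (es.flatMap fun e => e.1.2.2.1) q := by
  induction es with
  | nil => rintro p q rfl; exact Path.nil _
  | cons e es ih =>
    rintro p q ⟨rfl, h⟩
    exact Path.cons e.2 (ih h)

theorem Path.epath {E : P → Option (X × Bool) → List T → P → Prop} {p w o q}
    (h : Path E p w o q) : ∃ es : List (Ed E), EPath E p es q ∧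
      (es.flatMap fun e => e.1.2.1.toList) = w ∧ (es.flatMap fun e => e.1.2.2.1) = o := by
  induction h with
  | nil p => exact ⟨[], rfl, rfl, rfl⟩
  | @cons p l o q w o' r e _ ih =>
    obtain ⟨es, h, rfl, rfl⟩ := ih
    exact ⟨⟨(p, l, o, q), e⟩ :: es, ⟨rfl, h⟩, rfl, rfl⟩

theorem isRatTransOf_autoLang [Finite P] [Finite X]
    (E : P → Option (X × Bool) → List T → P → Prop) (S F : Set P)
    (hE : {e : P × Option (X × Bool) × List T × P | E e.1 e.2.1 e.2.2.1 e.2.2.2}.Finite) :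
    IsRatTransOf (twoSidedDyck (Fin 2)) (autoLang E S F : Set (FreeMonoid T)) := by
  obtain ⟨φ, hφ⟩ := exists_embedding X
  have : Finite (Ed E) := hE.to_subtype
  have : Fintype P := Fintype.ofFinite P
  let α : FreeMonoid (Ed E) →* FreeMonoid (Fin 2 × Bool) :=
    FreeMonoid.lift fun e => (φ (FreeGroup.mk e.1.2.1.toList)).toWord
  let β : FreeMonoid (Ed E) →* FreeMonoid T := FreeMonoid.lift fun e => (e.1.2.2.1 : List T)
  have hα : ∀ es : List (Ed E), FreeGroup.mk (α es) =
      φ (FreeGroup.mk (es.flatMap fun e => e.1.2.1.toList)) := by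
    intro es
    refine (congrArg FreeGroup.mk (lift_eq_flatMap _ es)).trans ?_
    induction es with
    | nil => exact (map_one φ).symm
    | cons e es ih =>
      rw [List.flatMap_cons, List.flatMap_cons, ← FreeGroup.mul_mk, ← FreeGroup.mul_mk, map_mul,
        ← ih, FreeGroup.mk_toWord]
  have hβ : ∀ es : List (Ed E), β es = es.flatMap fun e => e.1.2.2.1 := by
    exact fun es => lift_eq_flatMap _ es
  have htriv : ∀ es : List (Ed E), es ∈ (α ⁻¹' twoSidedDyck (Fin 2) : Set (FreeMonoid (Ed E))) ↔
      FreeGroup.mk (es.flatMap fun e => e.1.2.1.toList) = 1 := by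
    intro es
    show FreeGroup.mk (α es) = 1 ↔ _
    rw [hα, map_eq_one_iff φ hφ]
  refine ⟨Ed E, Fintype.ofFinite _, (edgeNFA E S F).accepts, α, β, ?_, ?_⟩
  · exact Language.isRegular_iff.2 ⟨Set P, Fintype.ofFinite _, (edgeNFA E S F).toDFA,
      NFA.toDFA_correct⟩
  · apply Set.ext
    intro o
    constructor
    · rintro ⟨s, hs, f, hf, w, hw, hp⟩
      obtain ⟨es, h1, rfl, rfl⟩ := hp.epath
      exact ⟨es, ⟨(htriv es).2 hw, f, hf, (mem_evalFrom_edgeNFA E S F es S f).2 ⟨s, hs, h1⟩⟩, hβ es⟩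
    · rintro ⟨es, ⟨h1, f, hf, h2⟩, rfl⟩
      obtain ⟨s, hs, h3⟩ := (mem_evalFrom_edgeNFA E S F es S f).1 h2
      refine ⟨s, hs, f, hf, _, (htriv es).1 h1, ?_⟩
      have hp := EPath.path es h3
      exact (show (β es : List T) = _ from hβ es) ▸ hp

end ToTrans

section FromCF

variable {T : Type}

/-- Dotted items of a grammar. -/
abbrev Item (g : ContextFreeGrammar T) (m : ℕ) : Type := {r // r ∈ g.rules} × Fin (m + 1)

/-- The recursive transition network of a grammar. -/
inductive GEdge (g : ContextFreeGrammar T) (m : ℕ) :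
    Item g m → Option (Item g m × Bool) → List T → Item g m → Prop
  | term (r : {r // r ∈ g.rules}) (i j : Fin (m + 1)) (a : T) (hj : j.val = i.val + 1)
      (h : r.1.output.drop i.val = .terminal a :: r.1.output.drop j.val) :
      GEdge g m (r, i) none [a] (r, j)
  | push (r : {r // r ∈ g.rules}) (i : Fin (m + 1)) (r' : {r // r ∈ g.rules})
      (h : ∃ s, r.1.output.drop i.val = .nonterminal r'.1.input :: s) :
      GEdge g m (r, i) (some ((r, i), true)) [] (r', 0)
  | pop (r : {r // r ∈ g.rules}) (i j : Fin (m + 1)) (r' : {r // r ∈ g.rules}) (k : Fin (m + 1))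
      (hj : j.val = i.val + 1) (hk : k.val = r'.1.output.length) :
      GEdge g m (r', k) (some ((r, i), false)) [] (r, j)

/-- What trivial paths in the network mean. -/
def GSem (g : ContextFreeGrammar T) (m : ℕ) (p : Item g m) (o : List T) (q : Item g m) : Prop :=
  p.1 = q.1 ∧ ∃ s, p.2.val + s.length = q.2.val ∧
    p.1.1.output.drop p.2.val = s ++ p.1.1.output.drop q.2.val ∧ g.Derives s (o.map .terminal)

theorem drop_succ_of {S : Type} {l : List S} {i j : ℕ} {x : S} {s : List S} (hj : j = i + 1)
    (h : l.drop i = x :: s) : l.drop j = s := by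
  rw [hj, ← List.drop_drop, h]; rfl

theorem gsem_of_path (g : ContextFreeGrammar T) (m : ℕ) {p w o q}
    (h : Path (GEdge g m) p w o q) (hw : FreeGroup.mk w = 1) : GSem g m p o q := by
  refine path_closed (GSem g m) ?_ ?_ ?_ ?_ h hw
  · exact fun p => ⟨rfl, [], rfl, rfl, Relation.ReflTransGen.refl⟩
  · rintro ⟨p, i⟩ ⟨q, j⟩ ⟨r, k⟩ o o' ⟨h1, s, h2, h3, h4⟩ ⟨h1', s', h2', h3', h4'⟩
    simp only at h1 h2 h3 h4 h1' h2' h3' h4'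
    subst h1 h1'
    refine ⟨rfl, s ++ s', ?_, ?_, ?_⟩
    · simp only [List.length_append]; omega
    · simp only; rw [h3, h3', List.append_assoc]
    · rw [List.map_append]
      exact (h4.append_right _).trans (h4'.append_left _)
  · intro p o q h
    cases h with
    | term r i j a hj h =>
      exact ⟨rfl, [.terminal a], hj.symm, h, Relation.ReflTransGen.refl⟩
  · intro p p' q' q x b o1 o2 o3 h1 h2 h3
    cases h1 with
    | push r i r' h =>
      obtain ⟨s, hs⟩ := h
      cases h3 with
      | pop _ _ j r'' k hj hk =>
        obtain ⟨e, t, ht1, ht2, ht3⟩ := h2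
        simp only at e ht1 ht2 ht3
        subst e
        refine ⟨rfl, [.nonterminal r'.1.input], hj.symm, ?_, ?_⟩
        · simp only
          rw [drop_succ_of hj hs, hs]; rfl
        · rw [hk, List.drop_length] at ht2
          simp only [Fin.val_zero, List.drop_zero, List.append_nil] at ht2
          rw [← ht2] at ht3
          refine Relation.ReflTransGen.head
            ⟨r'.1, r'.2, ContextFreeRule.Rewrites.input_output⟩ ?_
          simpa using ht3
    | pop r i j r' k hj hk =>
      cases h3 with
      | push _ _ r'' h =>
        obtain ⟨_, t, ht1, _⟩ := h2
        simp only at ht1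
        omega

theorem language_eq_autoLang (g : ContextFreeGrammar T) (m : ℕ)
    (hm : ∀ r ∈ g.rules, r.output.length ≤ m) :
    g.language = (autoLang (GEdge g m) {p | p.1.1.input = g.initial ∧ p.2 = 0}
      {p | p.2.val = p.1.1.output.length} : Set (List T)) := by
  apply Set.ext
  intro o
  constructor
  · intro ho
    let I : g.NT → Language T := fun A => {o | ∃ r : {r // r ∈ g.rules}, r.1.input = A ∧
      ∃ w, FreeGroup.mk w = 1 ∧ ∃ k : Fin (m + 1), k.val = r.1.output.length ∧
        Path (GEdge g m) (r, 0) w o (r, k)}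
    have key : ∀ (r : {r // r ∈ g.rules}) (k : Fin (m + 1)), k.val = r.1.output.length →
        ∀ (s : List (Symbol T g.NT)) (i : Fin (m + 1)), r.1.output.drop i.val = s →
        i.val ≤ r.1.output.length →
        ∀ o, o ∈ evs I s → ∃ w, FreeGroup.mk w = 1 ∧ Path (GEdge g m) (r, i) w o (r, k) := by
      intro r k hk s
      induction s with
      | nil =>
        intro i hi hle o ho
        cases ho
        have : i = k := Fin.ext (by rw [List.drop_eq_nil_iff] at hi; omega)
        rw [this]
        exact ⟨[], rfl, Path.nil _⟩
      | cons x s ih =>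
        intro i hi hle o ho
        have hlt : i.val < r.1.output.length := by
          by_contra hc
          rw [List.drop_eq_nil_of_le (by omega)] at hi
          simp at hi
        have hrm := hm r.1 r.2
        let j : Fin (m + 1) := ⟨i.val + 1, by omega⟩
        have hjs : r.1.output.drop j.val = s := drop_succ_of rfl hi
        cases x with
        | terminal a =>
          obtain ⟨o1, h1, o2, h2, rfl⟩ := Language.mem_mul.1 ho
          obtain rfl : o1 = [a] := h1
          obtain ⟨w, hw, hp⟩ := ih j hjs hlt o2 h2
          exact ⟨w, hw, Path.cons (GEdge.term r i j a rfl (by rw [hi, hjs])) hp⟩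
        | nonterminal A =>
          obtain ⟨o1, ⟨r', rfl, w', hw', k', hk', hp'⟩, o2, h2, rfl⟩ := Language.mem_mul.1 ho
          obtain ⟨w, hw, hp⟩ := ih j hjs hlt o2 h2
          have e1 := Path.single (GEdge.push (m := m) r i r' ⟨s, hi⟩)
          have e2 := Path.single (GEdge.pop (m := m) r i j r' k' rfl hk')
          have hp3 := ((e1.trans hp').trans e2).trans hp
          simp only [List.nil_append, List.append_nil] at hp3
          refine ⟨_, ?_, hp3⟩
          rw [← FreeGroup.mul_mk, ← FreeGroup.mul_mk, ← FreeGroup.mul_mk, hw, hw', mul_one,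
            mul_one, FreeGroup.mul_mk]
          exact (FreeGroup.Red.exact.2 ⟨[], Relation.ReflTransGen.single
            (FreeGroup.Red.Step.not (L₁ := []) (L₂ := [])), Relation.ReflTransGen.refl⟩)
    obtain ⟨r, hr, w, hw, k, hk, hp⟩ := language_le g I (by
      intro r hr o ho
      have hrm := hm r hr
      obtain ⟨w, hw, hp⟩ := key ⟨r, hr⟩ ⟨r.output.length, by omega⟩ rfl r.output 0 rfl
        (Nat.zero_le _) o ho
      exact ⟨⟨r, hr⟩, rfl, w, hw, _, rfl, hp⟩) o ho
    exact ⟨(r, 0), ⟨hr, rfl⟩, (r, k), hk, w, hw, hp⟩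
  · rintro ⟨⟨r, i⟩, ⟨h1, h2⟩, ⟨q, k⟩, hk, w, hw, hp⟩
    obtain ⟨e, s, h3, h4, h5⟩ := gsem_of_path g m hp hw
    simp only [Set.mem_ofPred_eq] at e h1 h2 hk h3 h4
    subst e h2
    rw [hk, List.drop_length] at h4
    simp only [Fin.val_zero, List.drop_zero, List.append_nil] at h4
    rw [← h4] at h5
    show g.Derives _ _
    rw [← h1]
    exact Relation.ReflTransGen.head ⟨r.1, r.2, ContextFreeRule.Rewrites.input_output⟩ h5

theorem finite_gedge [Finite T] (g : ContextFreeGrammar T) (m : ℕ) :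
    {e : Item g m × Option (Item g m × Bool) × List T × Item g m |
      GEdge g m e.1 e.2.1 e.2.2.1 e.2.2.2}.Finite := by
  refine ((Set.finite_univ (α := Item g m)).prod
    ((Set.finite_univ (α := Option (Item g m × Bool))).prod
    ((List.finite_length_le T 1).prod (Set.finite_univ (α := Item g m))))).subset ?_
  rintro ⟨p, l, o, q⟩ h
  refine ⟨trivial, trivial, ?_, trivial⟩
  cases h <;> simp

end FromCF

end CSProof

/-- Chomsky–Schützenberger: a language is context-free iff it is a rational
transduction of the two-sided Dyck language on two letters, i.e. of the word
problem of the free group of rank 2. -/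
theorem isContextFree_iff_ratTrans_twoSidedDyck
    {Sg : Type} [Fintype Sg] (L : Language Sg) :
    L.IsContextFree ↔ IsRatTransOf (twoSidedDyck (Fin 2)) (L : Set (FreeMonoid Sg)) := by
  constructor
  · rintro ⟨g, rfl⟩
    have hm : ∀ r ∈ g.rules, r.output.length ≤ g.rules.sup fun r => r.output.length :=
      fun r hr => Finset.le_sup (f := fun r => r.output.length) hr
    rw [CSProof.language_eq_autoLang g _ hm]
    exact CSProof.isRatTransOf_autoLang _ _ _ (CSProof.finite_gedge g _)
  · rintro ⟨Z, hZ, R, α, β, ⟨Q, hQ, M, rfl⟩, h⟩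
    have := CSProof.isContextFree_of_trans M α β
    exact (show L = _ from h) ▸ this
end

section
/- A language L ⊆ Σ* over a finite alphabet Σ is context-free if and only if L is a rational transduction of the one-sided (semi-)Dyck language on two letters, i.e., of the identity language of the polycyclic monoid of rank 2. -/
/-- The one-sided (semi-)Dyck language over the alphabet `X × Bool`
(`(x, true)` is the positive letter `x`, `(x, false)` is `x⁻¹`): the smallest
language containing the empty word, closed under concatenation, and containing
`x·u·x⁻¹` whenever it contains `u`.  It is the identity language of the
polycyclic monoid on `X`. -/
inductive IsSemiDyck {X : Type*} : List (X × Bool) → Prop where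
  | nil : IsSemiDyck []
  | append {u v : List (X × Bool)} : IsSemiDyck u → IsSemiDyck v → IsSemiDyck (u ++ v)
  | wrap {u : List (X × Bool)} (x : X) :
      IsSemiDyck u → IsSemiDyck ((x, true) :: (u ++ [(x, false)]))

namespace CSProof

/-! ### Stack machine semantics of the semi-Dyck language -/

/-- Run a word of pushes and pops on a stack. -/
def run {X : Type*} [DecidableEq X] : List (X × Bool) → List X → Option (List X)
  | [], s => some s
  | (x, true) :: w, s => run w (x :: s)
  | (_, false) :: _, [] => none
  | (x, false) :: w, y :: s => if x = y then run w s else none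

theorem run_append {X : Type*} [DecidableEq X] (u v : List (X × Bool)) (s : List X) :
    run (u ++ v) s = (run u s).bind (run v) := by
  induction u generalizing s with
  | nil => simp [run]
  | cons a u ih =>
    obtain ⟨x, b⟩ := a
    cases b
    · cases s with
      | nil => simp [run]
      | cons y s =>
        by_cases h : x = y <;> simp [run, h, ih]
    · simp [run, ih]

theorem run_of_dyck {X : Type*} [DecidableEq X] {u : List (X × Bool)} (h : IsSemiDyck u)
    (s : List X) : run u s = some s := by
  induction h generalizing s with
  | nil => rfl
  | append _ _ ih1 ih2 => simp [run_append, ih1, ih2]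
  | wrap x _ ih => simp [run, run_append, ih]

theorem dyck_insert {X : Type*} (x : X) {w : List (X × Bool)} (h : IsSemiDyck w) :
    ∀ u v, w = u ++ v → IsSemiDyck (u ++ (x, true) :: (x, false) :: v) := by
  have hxx : IsSemiDyck [(x, true), (x, false)] := by
    simpa using IsSemiDyck.wrap x IsSemiDyck.nil
  induction h with
  | nil =>
    intro u v h
    obtain ⟨rfl, rfl⟩ : u = [] ∧ v = [] := by simpa using h.symm
    exact hxx
  | append h1 h2 ih1 ih2 =>
    intro u v h
    rcases List.append_eq_append_iff.1 h with ⟨a, h1', h2'⟩ | ⟨a, h1', h2'⟩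
    · subst h1'
      rw [List.append_assoc]
      exact h1.append (ih2 _ _ h2')
    · subst h2'
      have := (ih1 _ _ h1').append h2
      simpa using this
  | wrap y hu ih =>
    intro u v h
    cases u with
    | nil =>
      simp only [List.nil_append] at h
      subst h
      exact hxx.append (IsSemiDyck.wrap y hu)
    | cons c u =>
      simp only [List.cons_append, List.cons.injEq] at h
      obtain ⟨rfl, h⟩ := h
      rcases List.eq_nil_or_concat v with rfl | ⟨v, d, rfl⟩
      · simp only [List.append_nil] at h
        subst h
        have := (IsSemiDyck.wrap y hu).append hxx
        simpa using this
      · rw [List.concat_eq_append, ← List.append_assoc] at h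
        obtain ⟨h1, h2⟩ := List.append_inj' h rfl
        simp only [List.cons.injEq, and_true] at h2
        subst h2
        have := IsSemiDyck.wrap y (ih _ _ h1)
        simpa using this

theorem dyck_of_run {X : Type*} [DecidableEq X] (w : List (X × Bool)) (s : List X)
    (h : run w s = some []) : IsSemiDyck ((s.reverse.map fun x => (x, true)) ++ w) := by
  induction w generalizing s with
  | nil =>
    simp only [run, Option.some.injEq] at h
    subst h
    exact IsSemiDyck.nil
  | cons a w ih =>
    obtain ⟨x, b⟩ := a
    cases b
    · cases s with
      | nil => simp [run] at h
      | cons y s =>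
        by_cases hxy : x = y
        · subst hxy
          simp only [run, if_true] at h
          have := dyck_insert x (ih s h) _ _ rfl
          simpa using this
        · simp [run, hxy] at h
    · have := ih (x :: s) h
      simpa using this

theorem dyck_iff_run {X : Type*} [DecidableEq X] (w : List (X × Bool)) :
    IsSemiDyck w ↔ run w [] = some [] :=
  ⟨fun h => run_of_dyck h [], fun h => by simpa using dyck_of_run w [] h⟩

/-! ### List form of rational transductions -/

theorem hom_toList {Z A : Type*} (α : FreeMonoid Z →* FreeMonoid A) (zs : List Z) :
    FreeMonoid.toList (α (FreeMonoid.ofList zs)) =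
      zs.flatMap fun z => FreeMonoid.toList (α (FreeMonoid.of z)) := by
  induction zs with
  | nil => simp
  | cons z zs ih => simp [FreeMonoid.ofList_cons, ih]

/-- List version of rational transduction of the Dyck language. -/
def RT {Sg : Type} (L : Language Sg) : Prop :=
  ∃ (Z : Type) (_ : Fintype Z) (R : Language Z) (a : Z → List (Fin 2 × Bool)) (b : Z → List Sg),
    R.IsRegular ∧ ∀ w, w ∈ L ↔ ∃ zs ∈ R, IsSemiDyck (zs.flatMap a) ∧ zs.flatMap b = w

theorem rt_iff {Sg : Type} (L : Language Sg) :
    IsRatTransOf {w : FreeMonoid (Fin 2 × Bool) | IsSemiDyck (FreeMonoid.toList w)}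
        (L : Set (FreeMonoid Sg)) ↔ RT L := by
  constructor
  · rintro ⟨Z, hZ, R, α, β, hR, h⟩
    refine ⟨Z, hZ, R, fun z => FreeMonoid.toList (α (FreeMonoid.of z)),
      fun z => FreeMonoid.toList (β (FreeMonoid.of z)), hR, fun w => ?_⟩
    have hw : w ∈ L ↔ FreeMonoid.ofList w ∈ β '' (α ⁻¹' {w | IsSemiDyck (FreeMonoid.toList w)} ∩
        (R : Set (FreeMonoid Z))) := by
      rw [← h]; rfl
    rw [hw]
    constructor
    · rintro ⟨zs, ⟨h1, h2⟩, h3⟩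
      refine ⟨FreeMonoid.toList zs, h2, ?_, ?_⟩
      · rw [← hom_toList]; exact h1
      · rw [← hom_toList]; exact h3
    · rintro ⟨zs, h2, h1, h3⟩
      refine ⟨FreeMonoid.ofList zs, ⟨?_, h2⟩, ?_⟩
      · rw [← hom_toList] at h1; exact h1
      · rw [← hom_toList] at h3; exact h3
  · rintro ⟨Z, hZ, R, a, b, hR, h⟩
    let α : FreeMonoid Z →* FreeMonoid (Fin 2 × Bool) :=
      FreeMonoid.lift fun z => FreeMonoid.ofList (a z)
    let β : FreeMonoid Z →* FreeMonoid Sg := FreeMonoid.lift fun z => FreeMonoid.ofList (b z)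
    have hα : ∀ zs, FreeMonoid.toList (α (FreeMonoid.ofList zs)) = zs.flatMap a := by
      intro zs; rw [hom_toList]; simp [α]
    have hβ : ∀ zs, FreeMonoid.toList (β (FreeMonoid.ofList zs)) = zs.flatMap b := by
      intro zs; rw [hom_toList]; simp [β]
    refine ⟨Z, hZ, R, α, β, hR, Set.ext fun w => ?_⟩
    refine (h (FreeMonoid.toList w)).trans ?_
    constructor
    · rintro ⟨zs, h2, h1, h3⟩
      refine ⟨FreeMonoid.ofList zs, ⟨?_, h2⟩, ?_⟩
      · rw [← hα] at h1; exact h1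
      · rw [← hβ] at h3; exact h3
    · rintro ⟨zs, ⟨h1, h2⟩, h3⟩
      refine ⟨FreeMonoid.toList zs, h2, ?_, ?_⟩
      · rw [← hα]; exact h1
      · rw [← hβ]; exact congrArg FreeMonoid.toList h3

/-! ### From grammars to transductions -/

/-- Leftmost derivations of terminal words. -/
inductive Yields {T : Type} (g : ContextFreeGrammar T) : List (Symbol T g.NT) → List T → Prop
  | nil : Yields g [] []
  | term (a : T) {γ w} : Yields g γ w → Yields g (Symbol.terminal a :: γ) (a :: w)
  | nt (r : ContextFreeRule T g.NT) (hr : r ∈ g.rules) {γ w} : Yields g (r.output ++ γ) w →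
      Yields g (Symbol.nonterminal r.input :: γ) w

theorem Yields.of_produces {T : Type} {g : ContextFreeGrammar T} {γ' : List (Symbol T g.NT)}
    {w : List T} (h : Yields g γ' w) : ∀ γ, g.Produces γ γ' → Yields g γ w := by
  induction h with
  | nil =>
    rintro γ ⟨r, hr, hrw⟩
    obtain ⟨p, q, rfl, h2⟩ := hrw.exists_parts
    simp only [List.nil_eq, List.append_eq_nil_iff] at h2
    obtain ⟨⟨rfl, h2⟩, rfl⟩ := h2
    refine Yields.nt r hr ?_
    simpa [h2] using Yields.nil
  | @term a δ w hy ih =>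
    rintro γ ⟨r, hr, hrw⟩
    obtain ⟨p, q, rfl, h2⟩ := hrw.exists_parts
    cases p with
    | nil =>
      refine Yields.nt r hr ?_
      simp only [List.nil_append] at h2
      change Yields g (r.output ++ q) _
      rw [← h2]
      exact hy.term a
    | cons c p =>
      simp only [List.cons_append, List.cons.injEq] at h2
      obtain ⟨rfl, rfl⟩ := h2
      exact Yields.term a (ih _ ⟨r, hr, ContextFreeRule.rewrites_of_exists_parts r p q⟩)
  | @nt r' hr' δ w hy ih =>
    rintro γ ⟨r, hr, hrw⟩
    obtain ⟨p, q, rfl, h2⟩ := hrw.exists_parts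
    cases p with
    | nil =>
      refine Yields.nt r hr ?_
      simp only [List.nil_append] at h2
      change Yields g (r.output ++ q) _
      rw [← h2]
      exact hy.nt r' hr'
    | cons c p =>
      simp only [List.cons_append, List.cons.injEq] at h2
      obtain ⟨rfl, rfl⟩ := h2
      refine Yields.nt r' hr' (ih _ ⟨r, hr, ?_⟩)
      exact (ContextFreeRule.rewrites_of_exists_parts r p q).append_left _

theorem Yields.terminals {T : Type} (g : ContextFreeGrammar T) (w : List T) :
    Yields g (w.map Symbol.terminal) w := by
  induction w with
  | nil => exact Yields.nil
  | cons a w ih => exact Yields.term a ih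

theorem Yields.of_derives {T : Type} {g : ContextFreeGrammar T} {γ : List (Symbol T g.NT)}
    {w : List T} (h : g.Derives γ (w.map Symbol.terminal)) : Yields g γ w := by
  induction h using Relation.ReflTransGen.head_induction_on with
  | refl => exact Yields.terminals g w
  | head h _ ih => exact ih.of_produces _ h

/-- Stack encoding of the number `n`, top of the stack first. -/
def enc (n : ℕ) : List (Fin 2) := List.replicate n 0 ++ [1]

/-- The word popping `enc n`. -/
def pop (n : ℕ) : List (Fin 2 × Bool) := (enc n).map fun x => (x, false)

/-- The word pushing the stack `s`. -/
def push (s : List (Fin 2)) : List (Fin 2 × Bool) := s.reverse.map fun x => (x, true)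

theorem run_push (s t : List (Fin 2)) : run (push s) t = some (s ++ t) := by
  induction s generalizing t with
  | nil => rfl
  | cons x s ih =>
    have : push (x :: s) = push s ++ [(x, true)] := by simp [push]
    rw [this, run_append, ih]
    rfl

theorem run_pop_self (s t : List (Fin 2)) :
    run (s.map fun x => (x, false)) (s ++ t) = some t := by
  induction s with
  | nil => rfl
  | cons x s ih => simpa [run] using ih

theorem run_pop_eq (s t t' : List (Fin 2)) (h : run (s.map fun x => (x, false)) t = some t') :
    t = s ++ t' := by
  induction s generalizing t with
  | nil => simpa [run] using h
  | cons x s ih =>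
    cases t with
    | nil => simp [run] at h
    | cons y t =>
      by_cases hxy : x = y
      · subst hxy
        simp only [List.map_cons, run, if_true] at h
        rw [ih _ h]; rfl
      · simp [run, hxy] at h

theorem enc_inj (m n : ℕ) (s t : List (Fin 2)) (h : enc m ++ s = enc n ++ t) : m = n ∧ s = t := by
  induction m generalizing n with
  | zero =>
    cases n with
    | zero => simpa [enc] using h
    | succ n => simp [enc, List.replicate_succ] at h
  | succ m ih =>
    cases n with
    | zero => simp [enc, List.replicate_succ] at h
    | succ n =>
      have : enc m ++ s = enc n ++ t := by
        simpa [enc, List.replicate_succ] using h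
      simpa using ih n this

theorem enc_flatMap_cons {S : Type*} (f : S → ℕ) (b : S) (hb : ∀ a, f a = f b → a = b)
    (γ : List S) (t : List (Fin 2)) (h : (γ.flatMap fun s => enc (f s)) = enc (f b) ++ t) :
    ∃ γ', γ = b :: γ' ∧ t = γ'.flatMap fun s => enc (f s) := by
  cases γ with
  | nil => simp [enc] at h
  | cons c γ =>
    simp only [List.flatMap_cons] at h
    obtain ⟨h1, h2⟩ := enc_inj _ _ _ _ h
    exact ⟨γ, by rw [hb c h1], h2.symm⟩

/-- DFA for `none · (some _)*`. -/
def startDFA (Z : Type) : DFA (Option Z) (Option Bool) where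
  step s z := match s, z with
    | none, none => some true
    | some true, some _ => some true
    | _, _ => some false
  start := none
  accept := {some true}

theorem startDFA_dead {Z : Type} (w : List (Option Z)) :
    (startDFA Z).evalFrom (some false) w = some false := by
  induction w with
  | nil => rfl
  | cons z w ih => rw [DFA.evalFrom_cons]; exact ih

theorem startDFA_live {Z : Type} (w : List (Option Z)) :
    (startDFA Z).evalFrom (some true) w = some true ↔ ∃ zs : List Z, w = zs.map some := by
  induction w with
  | nil => simp
  | cons z w ih =>
    rw [DFA.evalFrom_cons]
    cases z with
    | none =>
      have : (startDFA Z).step (some true) none = some false := rfl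
      rw [this, startDFA_dead]
      simp only [Option.some.injEq, Bool.false_eq_true, false_iff, not_exists]
      intro zs h
      cases zs <;> simp at h
    | some z =>
      have : (startDFA Z).step (some true) (some z) = some true := rfl
      rw [this, ih]
      constructor
      · rintro ⟨zs, rfl⟩; exact ⟨z :: zs, rfl⟩
      · rintro ⟨zs, h⟩
        cases zs with
        | nil => simp at h
        | cons y zs =>
          simp only [List.map_cons, List.cons.injEq] at h
          exact ⟨zs, h.2⟩

theorem startDFA_accepts {Z : Type} (w : List (Option Z)) :
    w ∈ (startDFA Z).accepts ↔ ∃ zs : List Z, w = none :: zs.map some := by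
  have h0 : w ∈ (startDFA Z).accepts ↔ (startDFA Z).evalFrom none w = some true := Iff.rfl
  rw [h0]
  cases w with
  | nil => simp
  | cons z w =>
    rw [DFA.evalFrom_cons]
    cases z with
    | none =>
      have : (startDFA Z).step none none = some true := rfl
      rw [this, startDFA_live]
      simp
    | some z =>
      have : (startDFA Z).step none (some z) = some false := rfl
      rw [this, startDFA_dead]
      simp

section Forward

variable {T : Type} (g : ContextFreeGrammar T) (f : Symbol T g.NT → ℕ)

/-- Stack encoding of sentential forms. -/
def E (γ : List (Symbol T g.NT)) : List (Fin 2) := γ.flatMap fun s => enc (f s)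

/-- Stack action of a transition. -/
def act : {r // r ∈ g.rules} ⊕ T → List (Fin 2 × Bool)
  | .inl r => pop (f (.nonterminal r.1.input)) ++ push (E g f r.1.output)
  | .inr a => pop (f (.terminal a))

/-- Output of a transition. -/
def out : {r // r ∈ g.rules} ⊕ T → List T
  | .inl _ => []
  | .inr a => [a]

theorem E_eq_nil {γ : List (Symbol T g.NT)} (h : E g f γ = []) : γ = [] := by
  cases γ with
  | nil => rfl
  | cons c γ => simp [E, enc] at h

theorem fwd_complete {γ : List (Symbol T g.NT)} {w : List T} (h : Yields g γ w) :
    ∃ zs : List ({r // r ∈ g.rules} ⊕ T),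
      run (zs.flatMap (act g f)) (E g f γ) = some [] ∧ zs.flatMap (out g) = w := by
  induction h with
  | nil => exact ⟨[], rfl, rfl⟩
  | @term a γ w _ ih =>
    obtain ⟨zs, h1, h2⟩ := ih
    refine ⟨.inr a :: zs, ?_, ?_⟩
    · rw [List.flatMap_cons, run_append]
      have : run (act g f (.inr a)) (E g f (Symbol.terminal a :: γ)) = some (E g f γ) :=
        run_pop_self _ _
      rw [this]
      exact h1
    · rw [List.flatMap_cons, h2]; rfl
  | @nt r hr γ w _ ih =>
    obtain ⟨zs, h1, h2⟩ := ih
    refine ⟨.inl ⟨r, hr⟩ :: zs, ?_, ?_⟩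
    · rw [List.flatMap_cons, run_append]
      have : run (act g f (.inl ⟨r, hr⟩)) (E g f (Symbol.nonterminal r.input :: γ)) =
          some (E g f (r.output ++ γ)) := by
        have h3 : run (pop (f (.nonterminal r.input)))
          (E g f (Symbol.nonterminal r.input :: γ)) = some (E g f γ) := run_pop_self _ _
        simp only [act, run_append, h3, Option.bind_some, run_push]
        simp [E]
      rw [this]
      exact h1
    · rw [List.flatMap_cons, h2]; rfl

theorem fwd_sound (hf1 : ∀ a b, f a = f (.terminal b) → a = .terminal b)
    (hf2 : ∀ r ∈ g.rules, ∀ a, f a = f (.nonterminal r.input) → a = .nonterminal r.input)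
    (zs : List ({r // r ∈ g.rules} ⊕ T)) (γ : List (Symbol T g.NT))
    (h : run (zs.flatMap (act g f)) (E g f γ) = some []) :
    g.Derives γ ((zs.flatMap (out g)).map Symbol.terminal) := by
  induction zs generalizing γ with
  | nil =>
    have : E g f γ = [] := by simpa [run] using h
    rw [E_eq_nil g f this]
    exact ContextFreeGrammar.Derives.refl _
  | cons z zs ih =>
    rw [List.flatMap_cons, run_append] at h
    obtain ⟨s, hs, hrest⟩ := Option.bind_eq_some_iff.1 h
    cases z with
    | inr a =>
      obtain ⟨γ', rfl, rfl⟩ := enc_flatMap_cons f _ (fun c => hf1 c a) _ _ (run_pop_eq _ _ _ hs)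
      exact (ih γ' hrest).append_left [Symbol.terminal a]
    | inl r =>
      obtain ⟨r, hr⟩ := r
      simp only [act, run_append] at hs
      obtain ⟨s', hs', h'⟩ := Option.bind_eq_some_iff.1 hs
      obtain ⟨γ', rfl, rfl⟩ := enc_flatMap_cons f _ (hf2 r hr) _ _ (run_pop_eq _ _ _ hs')
      rw [run_push] at h'
      have h3 : s = E g f (r.output ++ γ') := by
        simp only [Option.some.injEq] at h'
        rw [← h']; simp [E]
      rw [h3] at hrest
      exact ContextFreeGrammar.Produces.trans_derives
        ⟨r, hr, ContextFreeRule.Rewrites.head γ'⟩ (ih _ hrest)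

end Forward

theorem rt_of_cf {Sg : Type} [Fintype Sg] (L : Language Sg) (h : L.IsContextFree) : RT L := by
  classical
  obtain ⟨g, rfl⟩ := h
  let F : List (Symbol Sg g.NT) :=
    (Finset.univ : Finset Sg).toList.map Symbol.terminal ++
      g.rules.toList.map fun r => Symbol.nonterminal r.input
  let f : Symbol Sg g.NT → ℕ := fun s => F.idxOf s
  have hf : ∀ b ∈ F, ∀ a, f a = f b → a = b := fun b hb a h =>
    ((List.idxOf_inj hb).1 h.symm).symm
  have hf1 : ∀ a b, f a = f (.terminal b) → a = .terminal b := fun a b => hf _ (by simp [F]) a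
  have hf2 : ∀ r ∈ g.rules, ∀ a, f a = f (.nonterminal r.input) → a = .nonterminal r.input :=
    fun r hr a => hf _ (by simp only [F, List.mem_append, List.mem_map, Finset.mem_toList]; exact Or.inr ⟨r, hr, rfl⟩) a
  let Z := {r // r ∈ g.rules} ⊕ Sg
  let a : Option Z → List (Fin 2 × Bool) := fun z =>
    z.elim (push (E g f [.nonterminal g.initial])) (act g f)
  let b : Option Z → List Sg := fun z => z.elim [] (out g)
  have ha : ∀ zs : List Z, (none :: zs.map some).flatMap a =
      push (E g f [.nonterminal g.initial]) ++ zs.flatMap (act g f) := by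
    intro zs; simp [a, List.flatMap_map]
  have hb : ∀ zs : List Z, (none :: zs.map some).flatMap b = zs.flatMap (out g) := by
    intro zs; simp [b, List.flatMap_map]
  refine ⟨Option Z, inferInstance, (startDFA Z).accepts, a, b,
    ⟨Option Bool, inferInstance, startDFA Z, rfl⟩, fun w => ?_⟩
  rw [ContextFreeGrammar.mem_language_iff]
  constructor
  · intro h
    obtain ⟨zs, h1, h2⟩ := fwd_complete g f (Yields.of_derives h)
    refine ⟨none :: zs.map some, (startDFA_accepts _).2 ⟨zs, rfl⟩, ?_, ?_⟩
    · rw [ha, dyck_iff_run, run_append, run_push]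
      simpa using h1
    · rw [hb, h2]
  · rintro ⟨zs', h1, h2, h3⟩
    obtain ⟨zs, rfl⟩ := (startDFA_accepts _).1 h1
    rw [ha, dyck_iff_run, run_append, run_push] at h2
    rw [hb] at h3
    rw [← h3]
    exact fwd_sound g f hf1 hf2 zs _ (by simpa using h2)

/-! ### From transductions to grammars -/

theorem derives_prod_le {T : Type} (g : ContextFreeGrammar T) (I : Symbol T g.NT → Language T)
    (hI : ∀ r ∈ g.rules, (r.output.map I).prod ≤ I (.nonterminal r.input))
    {u v : List (Symbol T g.NT)} (h : g.Derives u v) : (v.map I).prod ≤ (u.map I).prod := by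
  induction h with
  | refl => exact le_rfl
  | tail _ h ih =>
    refine le_trans ?_ ih
    obtain ⟨r, hr, hrw⟩ := h
    obtain ⟨p, q, rfl, rfl⟩ := hrw.exists_parts
    simp only [List.map_append, List.prod_append, List.map_cons, List.map_nil, List.prod_singleton]
    gcongr
    exact hI r hr

theorem mem_prod_terminals {T N : Type} (I : Symbol T N → Language T)
    (hI : ∀ a, [a] ∈ I (.terminal a)) (w : List T) : w ∈ ((w.map Symbol.terminal).map I).prod := by
  induction w with
  | nil => simp
  | cons a w ih =>
    simp only [List.map_cons, List.prod_cons]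
    exact Language.append_mem_mul (hI a) ih

theorem terminals_mem_prod {T N : Type} (I : Symbol T N → Language T)
    (hI : ∀ a, I (.terminal a) = ({[a]} : Set (List T))) (w v : List T)
    (h : v ∈ ((w.map Symbol.terminal).map I).prod) : v = w := by
  induction w generalizing v with
  | nil => simpa using h
  | cons a w ih =>
    simp only [List.map_cons, List.prod_cons] at h
    obtain ⟨x, hx, y, hy, rfl⟩ := Language.mem_mul.1 h
    rw [hI] at hx
    rw [ih y hy, show x = [a] from hx]
    rfl

section Backward

variable {T Z σ : Type} (M : DFA Z σ) (a : Z → List (Fin 2 × Bool)) (b : Z → List T)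

/-- States of the expanded automaton. -/
abbrev St (σ : Type) := σ × List (Fin 2 × Bool)

/-- Nonterminals of the triple construction. -/
abbrev NTm (σ : Type) := Option (St σ × St σ)

/-- Rule for the empty path. -/
def ruleE (p : St σ) : ContextFreeRule T (NTm σ) := ⟨some (p, p), []⟩

/-- Rule for reading a letter. -/
def ruleR (s : σ) (z : Z) (q : St σ) : ContextFreeRule T (NTm σ) :=
  ⟨some ((s, []), q), (b z).map Symbol.terminal ++ [.nonterminal (some ((M.step s z, a z), q))]⟩

/-- Rule for a matched pair. -/
def ruleM (x : Fin 2) (p p' q : St σ) : ContextFreeRule T (NTm σ) :=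
  ⟨some ((p.1, (x, true) :: p.2), q),
    [.nonterminal (some (p, (p'.1, (x, false) :: p'.2))), .nonterminal (some (p', q))]⟩

/-- Initial rule. -/
def ruleS (t : σ) : ContextFreeRule T (NTm σ) :=
  ⟨none, [.nonterminal (some ((M.start, []), (t, [])))]⟩

/-- Interpretation of nonterminals. -/
def interp : Symbol T (NTm σ) → Language T
  | .terminal c => ({[c]} : Set (List T))
  | .nonterminal none => {w | ∃ zs ∈ M.accepts, IsSemiDyck (zs.flatMap a) ∧ zs.flatMap b = w}
  | .nonterminal (some (p, q)) => {w | ∃ zs d, M.evalFrom p.1 zs = q.1 ∧ IsSemiDyck d ∧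
      p.2 ++ zs.flatMap a = d ++ q.2 ∧ zs.flatMap b = w}

theorem interp_E (p : St σ) : ((ruleE (T := T) p).output.map (interp M a b)).prod ≤
    interp M a b (.nonterminal (ruleE (T := T) p).input) := by
  intro w hw
  have hw : w = [] := hw
  exact ⟨[], [], rfl, IsSemiDyck.nil, by simp [ruleE], hw.symm⟩

theorem interp_R (s : σ) (z : Z) (q : St σ) : ((ruleR M a b s z q).output.map (interp M a b)).prod ≤
    interp M a b (.nonterminal (ruleR M a b s z q).input) := by
  intro w hw
  simp only [ruleR, List.map_append, List.prod_append, List.map_cons, List.map_nil,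
    List.prod_singleton] at hw
  obtain ⟨x, hx, y, ⟨zs, d, h1, h2, h3, h4⟩, rfl⟩ := Language.mem_mul.1 hw
  have hx := terminals_mem_prod (interp M a b) (fun _ => rfl) _ _ hx
  refine ⟨z :: zs, d, ?_, h2, ?_, ?_⟩
  · rw [← h1]; rfl
  · rw [← h3]; simp [ruleR]
  · simp [hx, h4]

theorem interp_M (x : Fin 2) (p p' q : St σ) :
    ((ruleM (T := T) x p p' q).output.map (interp M a b)).prod ≤
      interp M a b (.nonterminal (ruleM (T := T) x p p' q).input) := by
  intro w hw
  simp only [ruleM, List.map_cons, List.map_nil, List.prod_cons, List.prod_nil, mul_one] at hw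
  obtain ⟨w1, ⟨zs, d, h1, h2, h3, h4⟩, w2, ⟨zs', d', h1', h2', h3', h4'⟩, rfl⟩ :=
    Language.mem_mul.1 hw
  simp only at h1 h3 h1' h3'
  refine ⟨zs ++ zs', ((x, true) :: (d ++ [(x, false)])) ++ d', ?_,
    (h2.wrap x).append h2', ?_, ?_⟩
  · rw [DFA.evalFrom_of_append, ← h1', ← h1]
  · simp only [List.flatMap_append, List.cons_append, List.append_assoc, List.nil_append]
    rw [← List.append_assoc p.2, h3, ← h3']
    simp
  · simp [h4, h4']

theorem interp_S (t : σ) (ht : t ∈ M.accept) :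
    ((ruleS (T := T) M t).output.map (interp M a b)).prod ≤
      interp M a b (.nonterminal (ruleS (T := T) M t).input) := by
  intro w hw
  simp only [ruleS, List.map_cons, List.map_nil, List.prod_singleton] at hw
  obtain ⟨zs, d, h1, h2, h3, h4⟩ := hw
  simp only [List.nil_append, List.append_nil] at h1 h3
  refine ⟨zs, ?_, ?_, h4⟩
  · have : M.evalFrom M.start zs ∈ M.accept := by rw [h1]; exact ht
    exact this
  · rw [h3]; exact h2

/-- Decomposition of a path that empties the stack. -/
def Chain (U : Finset (List (Fin 2 × Bool))) (Acc : St σ → St σ → List T → Prop) :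
    List (Fin 2) → St σ → St σ → List T → Prop
  | [], p, q, w => Acc p q w
  | x :: st, p, q, w => ∃ p' w1 w2, w = w1 ++ w2 ∧ Acc p (p'.1, (x, false) :: p'.2) w1 ∧
      (x, false) :: p'.2 ∈ U ∧ Chain U Acc st p' q w2

theorem cons_step (U : Finset (List (Fin 2 × Bool)))
    (hUt : ∀ c u, c :: u ∈ U → u ∈ U) (Acc : St σ → St σ → List T → Prop)
    (hE : ∀ p : St σ, p.2 ∈ U → Acc p p [])
    (hM : ∀ x (p p' q : St σ) w1 w2, p.2 ∈ U → p'.2 ∈ U → q.2 ∈ U →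
      Acc p (p'.1, (x, false) :: p'.2) w1 → Acc p' q w2 →
        Acc (p.1, (x, true) :: p.2) q (w1 ++ w2))
    (c : Fin 2 × Bool) (u : List (Fin 2 × Bool)) (hu : c :: u ∈ U) (q : St σ) (hq : q.2 ∈ U)
    {s : σ} (w : List T) (v : List (Fin 2 × Bool)) (st : List (Fin 2))
    (h : run (c :: u ++ v) st = some [])
    (ih : ∀ st', run (u ++ v) st' = some [] → Chain U Acc st' (s, u) q w) :
    Chain U Acc st (s, c :: u) q w := by
  obtain ⟨x, d⟩ := c
  cases d with
  | false =>
    cases st with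
    | nil => simp [run] at h
    | cons y st =>
      by_cases hxy : x = y
      · subst hxy
        simp only [List.cons_append, run, if_true] at h
        exact ⟨(s, u), [], w, rfl, hE _ hu, hu, ih st h⟩
      · simp [run, hxy] at h
  | true =>
    obtain ⟨p', w1, w2, rfl, h2, h3, h4⟩ := ih (x :: st) h
    cases st with
    | nil => exact hM x (s, u) p' q w1 w2 (hUt _ _ hu) (hUt _ _ h3) hq h2 h4
    | cons y st =>
      obtain ⟨p'', w3, w4, rfl, h5, h6, h7⟩ := h4
      exact ⟨p'', w1 ++ w3, w4, by simp,
        hM x (s, u) p' _ w1 w3 (hUt _ _ hu) (hUt _ _ h3) h6 h2 h5, h6, h7⟩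

theorem chain_of_run (U : Finset (List (Fin 2 × Bool))) (hU0 : [] ∈ U) (hUa : ∀ z, a z ∈ U)
    (hUt : ∀ c u, c :: u ∈ U → u ∈ U) (Acc : St σ → St σ → List T → Prop)
    (hE : ∀ p : St σ, p.2 ∈ U → Acc p p [])
    (hR : ∀ s z (q : St σ) w, q.2 ∈ U → Acc (M.step s z, a z) q w → Acc (s, []) q (b z ++ w))
    (hM : ∀ x (p p' q : St σ) w1 w2, p.2 ∈ U → p'.2 ∈ U → q.2 ∈ U →
      Acc p (p'.1, (x, false) :: p'.2) w1 → Acc p' q w2 →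
        Acc (p.1, (x, true) :: p.2) q (w1 ++ w2))
    (zs : List Z) (s : σ) (u : List (Fin 2 × Bool)) (hu : u ∈ U) (st : List (Fin 2))
    (h : run (u ++ zs.flatMap a) st = some []) :
    Chain U Acc st (s, u) (M.evalFrom s zs, []) (zs.flatMap b) := by
  induction zs generalizing s u st with
  | nil =>
    induction u generalizing st with
    | nil =>
      have : st = [] := by simpa [run] using h
      subst this
      exact hE _ hU0
    | cons c u ih =>
      exact cons_step U hUt Acc hE hM c u hu _ hU0 _ _ st h
        (fun st' h' => ih (hUt _ _ hu) st' h')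
  | cons z zs ihz =>
    induction u generalizing st with
    | nil =>
      have h1 := ihz (M.step s z) (a z) (hUa z) st (by simpa using h)
      cases st with
      | nil => exact hR _ _ _ _ hU0 h1
      | cons y st =>
        obtain ⟨p', w1, w2, hw, h2, h3, h4⟩ := h1
        refine ⟨p', b z ++ w1, w2, ?_, hR _ _ _ _ h3 h2, h3, h4⟩
        simp [hw]
    | cons c u ih =>
      exact cons_step U hUt Acc hE hM c u hu _ hU0 _ _ st h
        (fun st' h' => ih (hUt _ _ hu) st' h')

end Backward

theorem cf_of_rt {Sg : Type} (L : Language Sg) (h : RT L) : L.IsContextFree := by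
  classical
  obtain ⟨Z, hZ, R, a, b, ⟨σ, hσ, M, rfl⟩, hL⟩ := h
  let U : Finset (List (Fin 2 × Bool)) :=
    insert [] (Finset.univ.biUnion fun z => (a z).tails.toFinset)
  have hU0 : [] ∈ U := by simp [U]
  have hUa : ∀ z, a z ∈ U := fun z => by
    simp only [U, Finset.mem_insert, Finset.mem_biUnion, List.mem_toFinset, List.mem_tails]
    exact Or.inr ⟨z, Finset.mem_univ _, List.suffix_refl _⟩
  have hUt : ∀ c u, c :: u ∈ U → u ∈ U := fun c u h => by
    simp only [U, Finset.mem_insert, Finset.mem_biUnion, List.mem_toFinset, List.mem_tails] at h ⊢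
    rcases h with h | ⟨z, _, hz⟩
    · simp at h
    · exact Or.inr ⟨z, Finset.mem_univ _, (List.suffix_cons c u).trans hz⟩
  let P : Finset (St σ) := Finset.univ ×ˢ U
  have hP : ∀ p : St σ, p.2 ∈ U → p ∈ P := fun p hp => by simp [P, hp]
  let rules : Finset (ContextFreeRule Sg (NTm σ)) :=
    P.image ruleE ∪
    (Finset.univ ×ˢ Finset.univ ×ˢ P).image (fun t : σ × Z × St σ => ruleR M a b t.1 t.2.1 t.2.2) ∪
    (Finset.univ ×ˢ P ×ˢ P ×ˢ P).image
      (fun t : Fin 2 × St σ × St σ × St σ => ruleM t.1 t.2.1 t.2.2.1 t.2.2.2) ∪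
    (Finset.univ.filter fun t => t ∈ M.accept).image (ruleS M)
  let g : ContextFreeGrammar Sg := ⟨NTm σ, none, rules⟩
  have mE : ∀ p : St σ, p.2 ∈ U → ruleE p ∈ rules := fun p hp => by
    simp only [rules, Finset.mem_union, Finset.mem_image]
    exact Or.inl (Or.inl (Or.inl ⟨p, hP p hp, rfl⟩))
  have mR : ∀ s z (q : St σ), q.2 ∈ U → ruleR M a b s z q ∈ rules := fun s z q hq => by
    simp only [rules, Finset.mem_union, Finset.mem_image]
    exact Or.inl (Or.inl (Or.inr ⟨(s, z, q), by simp [hP q hq], rfl⟩))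
  have mM : ∀ x (p p' q : St σ), p.2 ∈ U → p'.2 ∈ U → q.2 ∈ U → ruleM x p p' q ∈ rules :=
    fun x p p' q hp hp' hq => by
      simp only [rules, Finset.mem_union, Finset.mem_image]
      exact Or.inl (Or.inr ⟨(x, p, p', q), by simp [hP _ hp, hP _ hp', hP _ hq], rfl⟩)
  have mS : ∀ t ∈ M.accept, ruleS M t ∈ rules := fun t ht => by
    simp only [rules, Finset.mem_union, Finset.mem_image]
    exact Or.inr ⟨t, by simp [ht], rfl⟩
  have prod : ∀ r ∈ rules, g.Produces [.nonterminal r.input] r.output := fun r hr =>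
    ⟨r, hr, ContextFreeRule.Rewrites.input_output⟩
  refine ⟨g, ?_⟩
  ext w
  rw [hL, ContextFreeGrammar.mem_language_iff]
  constructor
  · intro h
    have h1 := derives_prod_le g (interp M a b) (fun r hr => ?_) h
    · have h2 := h1 (mem_prod_terminals (interp M a b) (fun _ => rfl) w)
      rw [List.map_singleton, List.prod_singleton] at h2
      exact h2
    · have hr : r ∈ rules := hr
      simp only [rules, Finset.mem_union, Finset.mem_image] at hr
      rcases hr with ((⟨p, _, rfl⟩ | ⟨t, _, rfl⟩) | ⟨t, _, rfl⟩) | ⟨t, ht, rfl⟩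
      · exact interp_E M a b p
      · exact interp_R M a b _ _ _
      · exact interp_M M a b _ _ _ _
      · exact interp_S M a b t (by simpa using ht)
  · rintro ⟨zs, hzs, hd, rfl⟩
    have key := chain_of_run M a b U hU0 hUa hUt
      (fun p q w => g.Derives [.nonterminal (some (p, q))] (w.map Symbol.terminal))
      (fun p hp => (prod _ (mE p hp)).single)
      (fun s z q w hq h => (prod _ (mR s z q hq)).trans_derives (by
        rw [List.map_append]
        exact h.append_left _))
      (fun x p p' q w1 w2 hp hp' hq h1 h2 => (prod _ (mM x p p' q hp hp' hq)).trans_derives (by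
        rw [List.map_append]
        exact (h1.append_right [_]).trans (h2.append_left _)))
      zs M.start [] hU0 [] (by simpa using (dyck_iff_run _).1 hd)
    exact (prod _ (mS _ hzs)).trans_derives key

end CSProof

/-- Chomsky–Schützenberger: a language is context-free iff it is a rational
transduction of the one-sided (semi-)Dyck language on two letters, i.e. of the
identity language of the polycyclic monoid of rank 2. -/
theorem isContextFree_iff_ratTrans_semiDyck
    {Sg : Type} [Fintype Sg] (L : Language Sg) :
    L.IsContextFree ↔
      IsRatTransOf {w : FreeMonoid (Fin 2 × Bool) | IsSemiDyck (FreeMonoid.toList w)}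
        (L : Set (FreeMonoid Sg)) := by
  rw [CSProof.rt_iff]
  exact ⟨CSProof.rt_of_cf L, CSProof.cf_of_rt L⟩
end

section
/- Let X be a finite set and let w ∈ X̄* be a word representing the identity element of the free group F(X). Suppose w = u·x·v where u, v ∈ X̄* and x ∈ X̄ is a single letter. Then either u has a suffix of the form x⁻¹·e where e ∈ X̄* represents the identity of F(X), or v has a prefix of the form e·x⁻¹ where e ∈ X̄* represents the identity of F(X). (Here x⁻¹ denotes the letter formally inverse to x.) -/
theorem fg_mk_insert {X : Type} (p q : List (X × Bool)) (a : X) (b : Bool) :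
    FreeGroup.mk (p ++ (a, b) :: (a, !b) :: q) = FreeGroup.mk (p ++ q) :=
  Quot.sound FreeGroup.Red.Step.not

theorem fg_insert {X : Type} (p q s t : List (X × Bool)) (y : X × Bool) (a : X) (b : Bool)
    (h : p ++ q = s ++ y :: t) :
    ∃ s' t', p ++ (a, b) :: (a, !b) :: q = s' ++ y :: t' ∧
      FreeGroup.mk s' = FreeGroup.mk s ∧ FreeGroup.mk t' = FreeGroup.mk t := by
  rcases List.append_eq_append_iff.1 h with ⟨c, rfl, hc⟩ | ⟨c, rfl, hc⟩
  · exact ⟨p ++ (a, b) :: (a, !b) :: c, t, by simp [hc], fg_mk_insert _ _ _ _, rfl⟩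
  · cases c with
    | nil =>
      simp only [List.nil_append] at hc
      exact ⟨s ++ (a, b) :: (a, !b) :: [], t, by simp [hc],
        by simpa using fg_mk_insert s [] a b, rfl⟩
    | cons z c =>
      simp only [List.cons_append, List.cons.injEq] at hc
      obtain ⟨rfl, rfl⟩ := hc
      exact ⟨s, c ++ (a, b) :: (a, !b) :: q, by simp, rfl, fg_mk_insert _ _ _ _⟩

theorem fg_aux {X : Type} (w : List (X × Bool)) (x : X × Bool)
    (h : FreeGroup.Red w []) : ∀ u v, w = u ++ x :: v →
    (∃ u' e, u = u' ++ (x.1, !x.2) :: e ∧ FreeGroup.mk e = 1) ∨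
      (∃ e v', v = e ++ (x.1, !x.2) :: v' ∧ FreeGroup.mk e = 1) := by
  induction h using Relation.ReflTransGen.head_induction_on with
  | refl => intro u v h; simp at h
  | head hs _ ih =>
    intro u v h
    cases hs with
    | @not L₁ L₂ a b =>
    rcases List.append_eq_append_iff.1 h with ⟨c, rfl, hc⟩ | ⟨c, rfl, hc⟩
    · rcases c with _ | ⟨c1, _ | ⟨c2, c⟩⟩
      · simp only [List.nil_append, List.cons.injEq] at hc
        obtain ⟨rfl, rfl⟩ := hc
        exact Or.inr ⟨[], L₂, by simp, rfl⟩
      · simp only [List.nil_append, List.cons_append, List.cons.injEq] at hc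
        obtain ⟨rfl, rfl, rfl⟩ := hc
        exact Or.inl ⟨L₁, [], by simp, rfl⟩
      · simp only [List.cons_append, List.cons.injEq] at hc
        obtain ⟨rfl, rfl, rfl⟩ := hc
        rcases ih (L₁ ++ c) v (by simp) with ⟨s, t, h1, h2⟩ | h
        · obtain ⟨s', t', h3, -, h5⟩ := fg_insert _ _ _ _ _ a b h1
          exact Or.inl ⟨s', t', h3, h5.trans h2⟩
        · exact Or.inr h
    · rcases c with _ | ⟨c1, c⟩
      · simp only [List.nil_append, List.cons.injEq] at hc
        obtain ⟨rfl, rfl⟩ := hc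
        exact Or.inr ⟨[], L₂, by simp, rfl⟩
      · simp only [List.cons_append, List.cons.injEq] at hc
        obtain ⟨rfl, rfl⟩ := hc
        rcases ih u (c ++ L₂) (by simp) with h | ⟨s, t, h1, h2⟩
        · exact Or.inl h
        · obtain ⟨s', t', h3, h4, -⟩ := fg_insert _ _ _ _ _ a b h1
          exact Or.inr ⟨s', t', h3, h4.trans h2⟩

/-- If `w = u·x·v` represents the identity of the free group `F(X)` (letters are
pairs in `X × Bool`, with `(a, true)` the generator `a` and `(a, false)` its
inverse `a⁻¹`), then either `u` has a suffix `x⁻¹·e` with `e` representing the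
identity, or `v` has a prefix `e·x⁻¹` with `e` representing the identity, where
`x⁻¹` is the letter formally inverse to `x`. -/
theorem freeGroup_decompose_around_letter
    {X : Type} [Fintype X] (w u v : List (X × Bool)) (x : X × Bool)
    (hw : w = u ++ x :: v) (h1 : FreeGroup.mk w = 1) :
    (∃ u' e, u = u' ++ (x.1, !x.2) :: e ∧ FreeGroup.mk e = 1) ∨
      (∃ e v', v = e ++ (x.1, !x.2) :: v' ∧ FreeGroup.mk e = 1) := by
  obtain ⟨c, hc, hn⟩ := FreeGroup.Red.exact.1 (h1.trans FreeGroup.one_eq_mk)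
  rw [FreeGroup.Red.nil_iff] at hn
  subst hn
  exact fg_aux w x hc u v hw
end

section
/- Let X be a finite set and let w ∈ X̄* be a word representing the identity element of the free group F(X). Then the following are equivalent: (i) w belongs to the one-sided Dyck language D'_X (i.e., w represents the identity of the polycyclic monoid P(X)); (ii) every prefix of w represents either a positive element of F(X) or the identity of F(X); (iii) the only minimum of w is the identity of F(X). -/
/-- An element of a free group is positive if it is a product of one or more
generators. -/
def IsPositive {X : Type*} (g : FreeGroup X) : Prop :=
  ∃ l : List X, l ≠ [] ∧ g = (l.map FreeGroup.of).prod

/-- `g` is a minimum of the word `w` if some prefix of `w` represents `g` and no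
prefix of `w` representing `g` is immediately followed in `w` by a negative
letter. -/
def IsMinimumOf {X : Type*} (g : FreeGroup X) (w : List (X × Bool)) : Prop :=
  (∃ u v, w = u ++ v ∧ FreeGroup.mk u = g) ∧
    ∀ u a v, w = u ++ (a, false) :: v → FreeGroup.mk u ≠ g

/-- The positive word on a list of generators. -/
def posWord {X : Type*} (l : List X) : List (X × Bool) := l.map (fun x => (x, true))

lemma posWord_append {X : Type*} (l m : List X) :
    posWord (l ++ m) = posWord l ++ posWord m := by simp [posWord]

lemma prod_eq_posWord {X : Type*} (l : List X) :
    (l.map FreeGroup.of).prod = FreeGroup.mk (posWord l) := by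
  induction l with
  | nil => rfl
  | cons a l ih =>
    rw [List.map_cons, List.prod_cons, ih, FreeGroup.of, FreeGroup.mul_mk]; rfl

lemma posWord_inj {X : Type*} {l m : List X}
    (h : FreeGroup.mk (posWord l) = FreeGroup.mk (posWord m)) : l = m := by
  classical
  have red : ∀ l : List X, FreeGroup.reduce (posWord l) = posWord l := by
    intro l
    apply FreeGroup.IsReduced.reduce_eq
    unfold FreeGroup.IsReduced posWord
    rw [List.isChain_map]
    induction l with
    | nil => simp
    | cons a l ih => cases l <;> simp_all
  have h2 : posWord l = posWord m := by
    rw [← red l, ← red m, ← FreeGroup.toWord_mk, ← FreeGroup.toWord_mk, h]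
  exact List.map_injective_iff.2 (fun a b h => by simpa using h) h2

lemma mk_cancel {X : Type*} (b : X) :
    FreeGroup.mk [(b, false)] * FreeGroup.mk [(b, true)] = 1 := by
  have : FreeGroup.mk [(b, false)] = (FreeGroup.mk [(b, true)])⁻¹ := by simp [FreeGroup.inv_mk, FreeGroup.invRev]
  rw [this, inv_mul_cancel]

lemma mk_pop {X : Type*} {u : List (X × Bool)} {l : List X} {b : X}
    (h : FreeGroup.mk (u ++ [(b, false)]) = FreeGroup.mk (posWord l)) :
    FreeGroup.mk u = FreeGroup.mk (posWord (l ++ [b])) := by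
  rw [posWord_append, ← FreeGroup.mul_mk, ← h, ← FreeGroup.mul_mk, mul_assoc]
  change _ = _ * (_ * FreeGroup.mk [(b, true)])
  rw [mk_cancel, mul_one]

lemma pos_iff {X : Type*} (g : FreeGroup X) :
    (IsPositive g ∨ g = 1) ↔ ∃ l, g = FreeGroup.mk (posWord l) := by
  constructor
  · rintro (⟨l, -, rfl⟩ | rfl)
    · exact ⟨l, prod_eq_posWord l⟩
    · exact ⟨[], rfl⟩
  · rintro ⟨l, rfl⟩
    by_cases hl : l = []
    · right; subst hl; rfl
    · left; exact ⟨l, hl, (prod_eq_posWord l).symm⟩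

lemma IsSemiDyck.insert {X : Type*} (x : X) {w : List (X × Bool)} (h : IsSemiDyck w) :
    ∀ p q, w = p ++ q → IsSemiDyck (p ++ ((x, true) :: (x, false) :: q)) := by
  have hx : IsSemiDyck [(x, true), (x, false)] := IsSemiDyck.wrap x IsSemiDyck.nil
  induction h with
  | nil =>
    intro p q h
    have h := h.symm
    rw [List.append_eq_nil_iff] at h
    obtain ⟨rfl, rfl⟩ := h
    exact hx
  | @append u v hu hv ihu ihv =>
    intro p q h
    rcases List.append_eq_append_iff.1 h with ⟨r, rfl, rfl⟩ | ⟨r, rfl, rfl⟩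
    · have := IsSemiDyck.append hu (ihv r q rfl)
      simpa using this
    · have := IsSemiDyck.append (ihu p r rfl) hv
      simpa using this
  | @wrap u y hu ih =>
    intro p q h
    cases p with
    | nil =>
      simp only [List.nil_append] at h
      subst h
      exact IsSemiDyck.append (u := [(x, true), (x, false)]) hx (IsSemiDyck.wrap y hu)
    | cons a p =>
      simp only [List.cons_append, List.cons.injEq] at h
      obtain ⟨rfl, h⟩ := h
      rcases List.append_eq_append_iff.1 h with ⟨r, hpr, hq⟩ | ⟨r, rfl, rfl⟩
      · cases r with
        | nil =>
          simp only [List.nil_append] at hq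
          subst hq hpr
          have := IsSemiDyck.wrap y (IsSemiDyck.append hu hx)
          simpa using this
        | cons c r =>
          simp only [List.cons_append, List.cons.injEq] at hq
          obtain ⟨rfl, hq⟩ := hq
          have hq := hq.symm
          rw [List.append_eq_nil_iff] at hq
          obtain ⟨rfl, rfl⟩ := hq
          subst hpr
          have := IsSemiDyck.append (IsSemiDyck.wrap y hu) hx
          simpa using this
      · have := IsSemiDyck.wrap y (ih p r rfl)
        simpa using this

lemma IsSemiDyck.mk_eq_one {X : Type*} {w : List (X × Bool)} (h : IsSemiDyck w) :
    FreeGroup.mk w = 1 := by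
  induction h with
  | nil => rfl
  | append _ _ ih1 ih2 => rw [← FreeGroup.mul_mk, ih1, ih2, one_mul]
  | @wrap u x _ ih =>
    rw [← List.singleton_append, ← FreeGroup.mul_mk, ← FreeGroup.mul_mk, ih, one_mul]
    exact mul_eq_one_comm.1 (mk_cancel x)

lemma IsSemiDyck.splits_pos {X : Type*} {w : List (X × Bool)} (h : IsSemiDyck w) :
    ∀ p q, w = p ++ q → ∃ l, FreeGroup.mk p = FreeGroup.mk (posWord l) := by
  induction h with
  | nil =>
    intro p q h
    have h := h.symm
    rw [List.append_eq_nil_iff] at h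
    obtain ⟨rfl, rfl⟩ := h
    exact ⟨[], rfl⟩
  | @append u v hu hv ihu ihv =>
    intro p q h
    rcases List.append_eq_append_iff.1 h with ⟨r, rfl, rfl⟩ | ⟨r, rfl, rfl⟩
    · rw [← FreeGroup.mul_mk, hu.mk_eq_one, one_mul]
      exact ihv _ _ rfl
    · exact ihu _ _ rfl
  | @wrap u y hu ih =>
    intro p q h
    cases p with
    | nil => exact ⟨[], rfl⟩
    | cons a p =>
      have h0 := h
      simp only [List.cons_append, List.cons.injEq] at h
      obtain ⟨rfl, h⟩ := h
      have key : ∀ p r, u = p ++ r →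
          ∃ l, FreeGroup.mk ((y, true) :: p) = FreeGroup.mk (posWord l) := by
        intro p r hp
        obtain ⟨l, hl⟩ := ih p r hp
        refine ⟨y :: l, ?_⟩
        rw [← List.singleton_append, ← FreeGroup.mul_mk, hl, FreeGroup.mul_mk]
        rfl
      rcases List.append_eq_append_iff.1 h with ⟨r, hpr, hq⟩ | ⟨r, rfl, rfl⟩
      · cases r with
        | nil => exact key _ [] (by simp [hpr])
        | cons c r =>
          simp only [List.cons_append, List.cons.injEq] at hq
          obtain ⟨rfl, hq⟩ := hq
          have hq := hq.symm
          rw [List.append_eq_nil_iff] at hq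
          obtain ⟨rfl, rfl⟩ := hq
          subst hpr
          exact ⟨[], (IsSemiDyck.wrap y hu).mk_eq_one⟩
      · exact key p r rfl

lemma dyck_of_splits {X : Type*} (v : List (X × Bool)) : ∀ s : List X,
    (∀ p q, v = p ++ q → ∃ l, FreeGroup.mk (posWord s ++ p) = FreeGroup.mk (posWord l)) →
    FreeGroup.mk (posWord s ++ v) = 1 → IsSemiDyck (posWord s ++ v) := by
  induction v with
  | nil =>
    intro s _ h
    rw [List.append_nil] at h
    have : s = [] := posWord_inj h
    subst this
    exact IsSemiDyck.nil
  | cons c v ih =>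
    intro s hp h
    obtain ⟨b, _ | _⟩ := c
    · obtain ⟨l, hl⟩ := hp [(b, false)] v rfl
      obtain rfl := posWord_inj (mk_pop hl)
      have e : ∀ t, FreeGroup.mk (posWord (l ++ [b]) ++ (b, false) :: t)
          = FreeGroup.mk (posWord l ++ t) := by
        intro t
        rw [← List.singleton_append (l := t), ← List.append_assoc (posWord _), ← FreeGroup.mul_mk, hl,
          FreeGroup.mul_mk]
      have := ih l (fun p q hq => by
        obtain ⟨m, hm⟩ := hp ((b, false) :: p) q (by rw [hq]; rfl)
        exact ⟨m, by rw [← hm, e]⟩) (by rw [← e, h])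
      have := this.insert b _ _ rfl
      simpa [posWord] using this
    · have e : ∀ t, posWord (s ++ [b]) ++ t = posWord s ++ (b, true) :: t := by
        intro t; simp [posWord]
      have := ih (s ++ [b]) (fun p q hq => by
        rw [e]; exact hp _ q (by rw [hq]; rfl)) (by rw [e, h])
      rwa [e] at this

lemma exists_pop {X : Type*} (v : List (X × Bool)) : ∀ s t : List X, s ≠ [] →
    (∀ p q, v = p ++ q → ∃ l, FreeGroup.mk (posWord (s ++ t) ++ p) = FreeGroup.mk (posWord l)) →
    FreeGroup.mk (posWord (s ++ t) ++ v) = 1 →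
    ∃ u a v', v = u ++ (a, false) :: v' ∧
      FreeGroup.mk (posWord (s ++ t) ++ u) = FreeGroup.mk (posWord s) := by
  induction v with
  | nil =>
    intro s t hs _ h
    rw [List.append_nil] at h
    have : s ++ t = [] := posWord_inj h
    simp_all
  | cons c v ih =>
    intro s t hs hp h
    obtain ⟨b, _ | _⟩ := c
    · rcases List.eq_nil_or_concat' t with rfl | ⟨t, b', rfl⟩
      · exact ⟨[], b, v, rfl, by simp⟩
      obtain ⟨l, hl⟩ := hp [(b, false)] v rfl
      have h3 := posWord_inj (mk_pop hl)
      rw [← List.append_assoc] at h3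
      obtain ⟨rfl, h4⟩ := List.append_inj' h3 rfl
      simp only [List.cons.injEq, and_true] at h4
      subst h4
      have e : ∀ r, FreeGroup.mk (posWord (s ++ (t ++ [b'])) ++ (b', false) :: r)
          = FreeGroup.mk (posWord (s ++ t) ++ r) := by
        intro r
        rw [← List.singleton_append (l := r), ← List.append_assoc (posWord _),
          ← FreeGroup.mul_mk, hl, FreeGroup.mul_mk]
      obtain ⟨u, a, v', rfl, hu⟩ := ih s t hs (fun p q hq => by
        obtain ⟨m, hm⟩ := hp ((b', false) :: p) q (by rw [hq]; rfl)
        exact ⟨m, by rw [← hm, e]⟩) (by rw [← e, h])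
      exact ⟨(b', false) :: u, a, v', rfl, by rw [e, hu]⟩
    · have e : ∀ r, posWord (s ++ (t ++ [b])) ++ r = posWord (s ++ t) ++ (b, true) :: r := by
        intro r; simp [posWord]
      obtain ⟨u, a, v', rfl, hu⟩ := ih s (t ++ [b]) hs (fun p q hq => by
        rw [e]; exact hp _ q (by rw [hq]; rfl)) (by rw [e, h])
      exact ⟨(b, true) :: u, a, v', rfl, by rw [← e, hu]⟩

/-- The exponent sum. -/
def expSum {X : Type*} : FreeGroup X →* Multiplicative ℤ :=
  FreeGroup.lift (fun _ => Multiplicative.ofAdd 1)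

lemma expSum_ge {X : Type*} (u : List (X × Bool)) :
    0 ≤ (expSum (FreeGroup.mk u)).toAdd + u.length := by
  induction u with
  | nil => simp [expSum]
  | cons c u ih =>
    obtain ⟨b, _ | _⟩ := c <;> simp [expSum] at ih ⊢ <;> omega

lemma expSum_neg {X : Type*} (u : List (X × Bool)) (a : X) :
    (expSum (FreeGroup.mk (u ++ [(a, false)]))).toAdd = (expSum (FreeGroup.mk u)).toAdd - 1 := by
  rw [← FreeGroup.mul_mk, map_mul, toAdd_mul, sub_eq_add_neg]
  congr 1

lemma pos_of_min {X : Type*} (w : List (X × Bool))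
    (h : ∀ g : FreeGroup X, IsMinimumOf g w → g = 1) (n : ℕ) :
    ∀ u v, w = u ++ v → (expSum (FreeGroup.mk u)).toAdd + w.length ≤ n →
      ∃ l, FreeGroup.mk u = FreeGroup.mk (posWord l) := by
  induction n with
  | zero =>
    intro u v huv hn
    refine ⟨[], h _ ⟨⟨u, v, huv, rfl⟩, ?_⟩⟩
    intro u' a v' hw he
    have h1 := expSum_ge (u' ++ [(a, false)])
    rw [expSum_neg, he] at h1
    rw [hw] at hn
    simp at h1 hn
    omega
  | succ n ih =>
    intro u v huv hn
    by_cases hm : IsMinimumOf (FreeGroup.mk u) w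
    · exact ⟨[], h _ hm⟩
    · have : ∃ u' a v', w = u' ++ (a, false) :: v' ∧ FreeGroup.mk u' = FreeGroup.mk u := by
        by_contra hc
        exact hm ⟨⟨u, v, huv, rfl⟩, fun u' a v' h1 h2 => hc ⟨u', a, v', h1, h2⟩⟩
      obtain ⟨u', a, v', hw, he⟩ := this
      obtain ⟨l, hl⟩ := ih (u' ++ [(a, false)]) v' (by simp [hw]) (by
        rw [expSum_neg, he]; push_cast at hn; omega)
      exact ⟨l ++ [a], by rw [← he]; exact mk_pop hl⟩

/-- For a word `w` representing the identity of the free group `F(X)`, the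
following are equivalent: (i) `w` lies in the one-sided Dyck language, i.e.
represents the identity of the polycyclic monoid `P(X)`; (ii) every prefix of
`w` represents a positive element or the identity of `F(X)`; (iii) the only
minimum of `w` is the identity of `F(X)`. -/
theorem semiDyck_tfae_of_freeGroup_identity
    {X : Type} [Fintype X] (w : List (X × Bool)) (h1 : FreeGroup.mk w = 1) :
    List.TFAE
      [IsSemiDyck w,
       ∀ u v : List (X × Bool), w = u ++ v →
         IsPositive (FreeGroup.mk u) ∨ FreeGroup.mk u = 1,
       ∀ g : FreeGroup X, IsMinimumOf g w ↔ g = 1] := by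
  simp only [pos_iff]
  tfae_have 1 → 2 := fun h => h.splits_pos
  tfae_have 2 → 1 := fun h => dyck_of_splits w [] h h1
  tfae_have 3 → 2 := fun h u v huv =>
    pos_of_min w (fun g => (h g).1) ((expSum (FreeGroup.mk u)).toAdd + w.length).toNat u v huv
      (Int.self_le_toNat _)
  tfae_have 2 → 3 := by
    intro h g
    constructor
    · rintro ⟨⟨u, v, huv, rfl⟩, hmin⟩
      obtain ⟨s, hs⟩ := h u v huv
      by_cases hs0 : s = []
      · subst hs0; exact hs
      exfalso
      have e : ∀ r, FreeGroup.mk (posWord (s ++ []) ++ r) = FreeGroup.mk (u ++ r) := by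
        intro r
        rw [List.append_nil, ← FreeGroup.mul_mk, ← hs, FreeGroup.mul_mk]
      obtain ⟨u', a, v', rfl, hu⟩ := exists_pop v s [] hs0 (fun p q hq => by
        rw [e]; exact h _ q (by rw [huv, hq, List.append_assoc])) (by rw [e, ← huv, h1])
      refine hmin (u ++ u') a v' (by rw [huv, List.append_assoc]) ?_
      rw [← e, hu, hs]
    · rintro rfl
      refine ⟨⟨[], w, rfl, rfl⟩, ?_⟩
      intro u a v hw hu
      obtain ⟨l, hl⟩ := h (u ++ [(a, false)]) v (by simp [hw])
      have h2 := mk_pop hl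
      rw [hu] at h2
      have : [] = l ++ [a] := posWord_inj h2
      simp at this
  tfae_finish
end

section
/- Let X be a finite set, let # be a symbol not in X, and write X# = X ∪ {#}. Let w ∈ (X#)̄* be a word in the one-sided Dyck language D'_{X#}, and suppose w = uv. Then there exists a factorization v = st such that (i) t is the empty word or t begins with a negative letter, and (ii) the word u·#·s·#⁻¹·t also belongs to D'_{X#}. -/
theorem semiDyck_split {Y : Type*} {w : List (Y × Bool)} (h : IsSemiDyck w) :
    ∀ u v : List (Y × Bool), w = u ++ v → ∃ s t : List (Y × Bool),
      v = s ++ t ∧ (t = [] ∨ ∃ (a : Y) (t' : List (Y × Bool)), t = (a, false) :: t') ∧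
      IsSemiDyck s ∧ ∀ z, IsSemiDyck z → IsSemiDyck (u ++ (z ++ t)) := by
  induction h with
  | nil =>
    intro u v h
    obtain ⟨rfl, rfl⟩ := List.append_eq_nil_iff.1 h.symm
    exact ⟨[], [], rfl, Or.inl rfl, .nil, fun z hz => by simpa using hz⟩
  | @append w1 w2 h1 h2 ih1 ih2 =>
    intro u v h
    rcases List.append_eq_append_iff.1 h with ⟨u', rfl, hv⟩ | ⟨v', hw, rfl⟩
    · obtain ⟨s, t, rfl, ht, hs, hz⟩ := ih2 u' v hv
      refine ⟨s, t, rfl, ht, hs, fun z hzz => ?_⟩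
      have := IsSemiDyck.append h1 (hz z hzz)
      simpa using this
    · obtain ⟨s, t, rfl, ht, hs, hz⟩ := ih1 u v' hw
      rcases ht with rfl | ⟨a, t', rfl⟩
      · refine ⟨s ++ w2, [], by simp, Or.inl rfl, hs.append h2, fun z hzz => hz z hzz⟩
      · refine ⟨s, (a, false) :: t' ++ w2, by simp, Or.inr ⟨a, t' ++ w2, rfl⟩, hs,
          fun z hzz => ?_⟩
        have := IsSemiDyck.append (hz z hzz) h2
        simpa using this
  | @wrap w0 x h0 ih =>
    intro u v h
    rcases u with _ | ⟨c, u'⟩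
    · refine ⟨v, [], by simp, Or.inl rfl, ?_, fun z hz => by simpa using hz⟩
      rw [List.nil_append] at h
      exact h ▸ IsSemiDyck.wrap x h0
    · rw [List.cons_append, List.cons.injEq] at h
      obtain ⟨rfl, h⟩ := h
      rcases List.eq_nil_or_concat v with rfl | ⟨v0, b, rfl⟩
      · refine ⟨[], [], rfl, Or.inl rfl, .nil, fun z hz => ?_⟩
        rw [List.append_nil] at h
        subst h
        simpa using (IsSemiDyck.wrap x h0).append hz
      · simp only [List.concat_eq_append] at *
        rw [← List.append_assoc] at h
        obtain ⟨h, hb⟩ := List.append_inj' h rfl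
        obtain ⟨s, t, rfl, ht, hs, hz⟩ := ih u' v0 h
        simp only [List.cons.injEq, and_true] at hb
        subst hb
        refine ⟨s, t ++ [(x, false)], by simp, Or.inr ?_, hs, fun z hzz => ?_⟩
        · rcases ht with rfl | ⟨a, t', rfl⟩
          · exact ⟨x, [], rfl⟩
          · exact ⟨a, t' ++ [(x, false)], rfl⟩
        · simpa using IsSemiDyck.wrap x (hz z hzz)

/-- Padding insertion lemma: if `u·v` lies in the one-sided Dyck language over
`X# = X ⊕ Unit` (where `Sum.inr ()` is the extra symbol `#`), then `v` factors
as `v = s·t` with `t` empty or beginning with a negative letter, such that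
`u·#·s·#⁻¹·t` also lies in the one-sided Dyck language. -/
theorem semiDyck_insert_padding
    {X : Type} [Fintype X] (u v : List ((X ⊕ Unit) × Bool))
    (h : IsSemiDyck (u ++ v)) :
    ∃ s t : List ((X ⊕ Unit) × Bool),
      v = s ++ t ∧
      (t = [] ∨ ∃ (a : X ⊕ Unit) (t' : List ((X ⊕ Unit) × Bool)), t = (a, false) :: t') ∧
      IsSemiDyck (u ++ ((Sum.inr (), true) :: (s ++ ((Sum.inr (), false) :: t)))) := by
  obtain ⟨s, t, hv, ht, hs, hz⟩ := semiDyck_split h u v rfl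
  refine ⟨s, t, hv, ht, ?_⟩
  have := hz _ (IsSemiDyck.wrap (Sum.inr ()) hs)
  simpa using this
end
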